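/- arXiv:1911.07666 — 2 statements merged into one kernel-verified Lean document; each statement's English description precedes it below -/
import Mathlib

section
/- Let R be a semilocal commutative ring and A a separable projective R-algebra with center S such that ℓ := rank_R S and n := deg A are constant. Then there exists a faithfully flat finite étale R-algebra T such that A⊗_R T ≅ M_n(S⊗_R T) as S⊗_R T-algebras. -/
open TensorProduct

noncomputable section

/-- A commutative ring is semilocal if it has only finitely many maximal ideals. -/
def IsSemilocalRing (R : Type*) [CommRing R] : Prop :=
  {I : Ideal R | I.IsMaximal}.Finite

/-- An `R`-algebra `A` is separable iff it admits a separability idempotent. -/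
def IsSeparableAlgebra (R : Type*) [CommRing R] (A : Type*) [Ring A] [Algebra R A] : Prop :=
  ∃ e : A ⊗[R] A, LinearMap.mul' R A e = 1 ∧
    ∀ b : A, LinearMap.rTensor A (LinearMap.mulLeft R b) e
           = LinearMap.lTensor A (LinearMap.mulRight R b) e

/-- A finite étale `R`-algebra. -/
def IsFiniteEtale (R : Type*) [CommRing R] (S : Type*) [CommRing S] [Algebra R S] : Prop :=
  Module.Finite R S ∧ Module.Projective R S ∧ IsSeparableAlgebra R S

/-- The residue field `k(p) = Frac(R ⧸ p)` of a prime ideal `p`. -/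
abbrev residueFieldAt (R : Type*) [CommRing R] (p : Ideal R) : Type _ :=
  FractionRing (R ⧸ p)

/-- The rank of an `R`-module at a prime `p`. -/
def rankAt (R : Type*) [CommRing R] (M : Type*) [AddCommGroup M] [Module R M]
    (p : Ideal R) : ℕ :=
  Module.finrank (residueFieldAt R p) (residueFieldAt R p ⊗[R] M)

open TensorProduct

lemma nak_aux {T : Type*} [CommRing T] {M : Type*} [AddCommGroup M] [Module T M]
    [Module.Finite T M] (N : Submodule T M)
    (h : ∀ m : Ideal T, m.IsMaximal → ∀ x : M, x ∈ N ⊔ m • (⊤ : Submodule T M)) : N = ⊤ := by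
  by_contra hN
  have hann : (N.colon (⊤ : Set M)) ≠ ⊤ := by
    intro h1
    apply hN
    rw [eq_top_iff]
    intro x _
    have : (1 : T) ∈ N.colon (⊤ : Set M) := by rw [h1]; trivial
    simpa using Submodule.mem_colon.1 this x trivial
  obtain ⟨m, hm, hle⟩ := Ideal.exists_le_maximal _ hann
  obtain ⟨r, hr1, hr2⟩ := Submodule.exists_sub_one_mem_and_smul_le_of_fg_of_le_sup
    (I := m) (N := N) (N' := (⊤ : Submodule T M)) (P := ⊤) Module.Finite.fg_top le_rfl
    (fun x _ => h m hm x)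
  apply hm.ne_top
  rw [Ideal.eq_top_iff_one]
  have hrm : r ∈ m := hle (Submodule.mem_colon.2 fun x _ => hr2 (Submodule.smul_mem_pointwise_smul x r _ trivial))
  have := m.sub_mem hrm hr1
  simpa using this

lemma mem_smul_top_of_tmul_eq_zero {T : Type*} [CommRing T] {M : Type*} [AddCommGroup M]
    [Module T M] (m : Ideal T) (x : M) (h : (1 : T ⧸ m) ⊗ₜ[T] x = 0) :
    x ∈ m • (⊤ : Submodule T M) := by
  have := congrArg (TensorProduct.quotTensorEquivQuotSMul M m) h
  rw [map_zero] at this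
  have h2 : TensorProduct.quotTensorEquivQuotSMul M m ((1 : T ⧸ m) ⊗ₜ[T] x)
      = Submodule.Quotient.mk x := by
    simpa using TensorProduct.quotTensorEquivQuotSMul_mk_tmul m (1 : T) x
  rw [h2] at this
  exact (Submodule.Quotient.mk_eq_zero _).1 this

lemma tmul_eq_zero_of_mem {T : Type*} [CommRing T] {M : Type*} [AddCommGroup M]
    [Module T M] (m : Ideal T) (x : M) (h : x ∈ m • (⊤ : Submodule T M)) :
     (1 : T ⧸ m) ⊗ₜ[T] x = 0 := by
  induction h using Submodule.smul_induction_on' with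
  | smul r hr y _ =>
    rw [← TensorProduct.smul_tmul]
    have : r • (1 : T ⧸ m) = 0 := by
      rw [Algebra.smul_def, mul_one]
      exact Ideal.Quotient.eq_zero_iff_mem.2 hr
    rw [this, TensorProduct.zero_tmul]
  | add x _ y _ hx hy => rw [TensorProduct.tmul_add, hx, hy, add_zero]

lemma unramified_of_fibers (R S : Type) [CommRing R] [CommRing S] [Algebra R S]
    [Module.Finite R S]
    (h : ∀ (K : Type) [Field K] [IsAlgClosed K] [Algebra R K], IsReduced (K ⊗[R] S)) :
    Algebra.FormallyUnramified R S := by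
  constructor
  have hfin : Module.Finite R (Ω[S⁄R]) := Module.Finite.trans S _
  suffices (⊥ : Submodule R (Ω[S⁄R])) = ⊤ from
    (Submodule.subsingleton_iff R).1 (subsingleton_of_bot_eq_top this)
  apply nak_aux
  intro m hm x
  rw [bot_sup_eq]
  apply mem_smul_top_of_tmul_eq_zero
  letI : Field (R ⧸ m) := Ideal.Quotient.field m
  let K := AlgebraicClosure (R ⧸ m)
  have hred : IsReduced (K ⊗[R] S) := h K
  have hf : Module.Finite K (K ⊗[R] S) := inferInstance
  have hart : IsArtinianRing (K ⊗[R] S) := IsArtinianRing.of_finite K _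
  have het : Algebra.FormallyEtale K (K ⊗[R] S) := by
    rw [Algebra.FormallyEtale.iff_exists_algEquiv_prod]
    have : Fintype (MaximalSpectrum (K ⊗[R] S)) := Fintype.ofFinite _
    refine ⟨MaximalSpectrum (K ⊗[R] S), inferInstance, fun I => (K ⊗[R] S) ⧸ I.asIdeal,
      fun I => Ideal.Quotient.field _, fun I => inferInstance, ?_, ?_⟩
    · exact AlgEquiv.ofRingEquiv (f := IsArtinianRing.equivPi (K ⊗[R] S)) (fun r => rfl)
    · intro I
      letI : Field ((K ⊗[R] S) ⧸ I.asIdeal) := Ideal.Quotient.field _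
      have : Algebra.IsAlgebraic K ((K ⊗[R] S) ⧸ I.asIdeal) := inferInstance
      infer_instance
  have hun : Algebra.FormallyUnramified K (K ⊗[R] S) := inferInstance
  let _ : Algebra S (K ⊗[R] S) := Algebra.TensorProduct.rightAlgebra
  have : Subsingleton (K ⊗[R] Ω[S⁄R]) :=
    (KaehlerDifferential.tensorKaehlerEquivBase R K S (K ⊗[R] S)).subsingleton
  have : Subsingleton (K ⊗[R ⧸ m] ((R ⧸ m) ⊗[R] Ω[S⁄R])) :=
    (TensorProduct.AlgebraTensorModule.cancelBaseChange R (R ⧸ m) K K (Ω[S⁄R])).subsingleton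
  have : Subsingleton ((R ⧸ m) ⊗[R] Ω[S⁄R]) :=
    Module.FaithfullyFlat.lTensor_reflects_triviality (R ⧸ m) K _
  exact Subsingleton.elim _ _

lemma etale_adjoinRoot {R : Type*} [CommRing R] (f : Polynomial R) (hf : f.Monic)
    (hs : f.Separable) : Algebra.Etale R (AdjoinRoot f) := by
  obtain ⟨a, b, hab⟩ := hs
  let P : StandardEtalePair R :=
    { f := f, monic_f := hf, g := 1, cond := ⟨b, a, 0, by rw [pow_zero]; linear_combination hab⟩ }
  have e := P.equivAwayAdjoinRoot
  have : Algebra.Etale R (Localization.Away (AdjoinRoot.mk P.f P.g)) := Algebra.Etale.of_equiv e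
  have hu : IsUnit (AdjoinRoot.mk P.f P.g) := by simp [P]
  have e2 : AdjoinRoot f ≃ₐ[AdjoinRoot f] (Localization.Away (AdjoinRoot.mk P.f P.g)) :=
    IsLocalization.atUnit _ _ (AdjoinRoot.mk P.f P.g) hu
  exact Algebra.Etale.of_equiv (e2.restrictScalars R).symm

lemma finrank_eq_rankAtStalk {T : Type} [CommRing T] (A : Type) [AddCommGroup A] [Module T A]
    [Module.Finite T A] [Module.Projective T A] (k : Type) [Field k] [Algebra T k] :
    Module.finrank k (k ⊗[T] A) = Module.rankAtStalk (R := T) A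
      (PrimeSpectrum.comap (algebraMap T k) ⊥) := by
  rw [← Module.rankAtStalk_baseChange, Module.rankAtStalk_eq_finrank_of_free]
  rfl

lemma rankAt_eq_rankAtStalk {T : Type} [CommRing T] (A : Type) [AddCommGroup A] [Module T A]
    [Module.Finite T A] [Module.Projective T A] (p : PrimeSpectrum T) :
    rankAt T A p.asIdeal = Module.rankAtStalk (R := T) A p := by
  have := p.2
  rw [rankAt, finrank_eq_rankAtStalk]
  congr 1
  ext x
  simp only [PrimeSpectrum.comap_asIdeal, Ideal.mem_comap]
  rw [IsScalarTower.algebraMap_apply T (T ⧸ p.asIdeal) (residueFieldAt T p.asIdeal)]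
  change _ ∈ (⊥ : Ideal _) ↔ _
  rw [Ideal.mem_bot]
  simp only [FaithfulSMul.algebraMap_eq_zero_iff]
  exact Ideal.Quotient.eq_zero_iff_mem

lemma isFiniteEtale_of_etale (R T : Type) [CommRing R] [CommRing T] [Algebra R T]
    [Module.Finite R T] [Module.Projective R T] [Algebra.Etale R T] : IsFiniteEtale R T := by
  refine ⟨inferInstance, inferInstance, ?_⟩
  obtain ⟨t, h1, h2⟩ := (Algebra.FormallyUnramified.iff_exists_tensorProduct (R := R) (S := T)).1
    inferInstance
  refine ⟨t, ?_, ?_⟩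
  · rw [← h2]; rfl
  · intro b
    have hl : ∀ t : T ⊗[R] T, LinearMap.rTensor T (LinearMap.mulLeft R b) t = (b ⊗ₜ 1) * t := by
      intro t
      induction t with
      | zero => simp
      | tmul x y => simp
      | add x y hx hy => rw [map_add, hx, hy, mul_add]
    have hr : ∀ t : T ⊗[R] T, LinearMap.lTensor T (LinearMap.mulRight R b) t = (1 ⊗ₜ b) * t := by
      intro t
      induction t with
      | zero => simp
      | tmul x y => simp [mul_comm]
      | add x y hx hy => rw [map_add, hx, hy, mul_add]
    rw [hl, hr]
    have := h1 b
    rw [sub_mul, sub_eq_zero] at this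
    exact this.symm

open TensorProduct

/-- Explicit form of separability. -/
lemma sep_iff {R A : Type*} [CommRing R] [Ring A] [Algebra R A] (h : IsSeparableAlgebra R A) :
    ∃ s : Finset (A × A), (∑ i ∈ s, i.1 * i.2 = 1) ∧
      ∀ b : A, ∑ i ∈ s, (b * i.1) ⊗ₜ[R] i.2 = ∑ i ∈ s, i.1 ⊗ₜ[R] (i.2 * b) := by
  obtain ⟨e, h1, h2⟩ := h
  obtain ⟨s, rfl⟩ := TensorProduct.exists_finset e
  refine ⟨s, by simpa using h1, fun b => by simpa using h2 b⟩

lemma sep_sandwich {R A : Type*} [CommRing R] [Ring A] [Algebra R A] {s : Finset (A × A)}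
    (h2 : ∀ b : A, ∑ i ∈ s, (b * i.1) ⊗ₜ[R] i.2 = ∑ i ∈ s, i.1 ⊗ₜ[R] (i.2 * b)) (a b : A) :
    b * ∑ i ∈ s, i.1 * a * i.2 = (∑ i ∈ s, i.1 * a * i.2) * b := by
  have := congrArg (LinearMap.mul' R A ∘ₗ LinearMap.rTensor A (LinearMap.mulRight R a)) (h2 b)
  simp only [map_sum, LinearMap.comp_apply, LinearMap.rTensor_tmul, LinearMap.mulRight_apply,
    LinearMap.mul'_apply] at this
  rw [Finset.mul_sum, Finset.sum_mul]
  simpa [mul_assoc] using this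

lemma sep_of_span {R k A B : Type*} [CommRing R] [CommRing k] [Ring A] [Ring B] [Algebra R A]
    [Algebra R k] [Algebra k B] [Algebra R B] [IsScalarTower R k B] (j : A →ₐ[R] B)
    (hj : Submodule.span k (Set.range j) = ⊤) (h : IsSeparableAlgebra R A) :
    IsSeparableAlgebra k B := by
  obtain ⟨s, h1, h2⟩ := sep_iff h
  refine ⟨∑ i ∈ s, j i.1 ⊗ₜ[k] j i.2, ?_, ?_⟩
  · simp only [map_sum, LinearMap.mul'_apply, ← map_mul]
    rw [← map_sum, h1, map_one]
  · intro b
    have hb : b ∈ Submodule.span k (Set.range j) := by rw [hj]; trivial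
    simp only [map_sum, LinearMap.rTensor_tmul, LinearMap.lTensor_tmul, LinearMap.mulLeft_apply,
      LinearMap.mulRight_apply]
    induction hb using Submodule.span_induction with
    | mem x hx =>
      obtain ⟨a, rfl⟩ := hx
      have := congrArg (TensorProduct.mapOfCompatibleSMul k R R B B ∘ₗ
        TensorProduct.map j.toLinearMap j.toLinearMap) (h2 a)
      simpa using this
    | zero => simp
    | add x y _ _ hx hy => simp [add_mul, mul_add, TensorProduct.add_tmul, TensorProduct.tmul_add,
        Finset.sum_add_distrib, hx, hy]
    | smul c x _ hx =>
      simp only [smul_mul_assoc, mul_smul_comm, TensorProduct.tmul_smul, ← TensorProduct.smul_tmul',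
        ← Finset.smul_sum, hx]

lemma sep_baseChange {R : Type*} (k : Type*) {A : Type*} [CommRing R] [CommRing k] [Ring A]
    [Algebra R A] [Algebra R k] (h : IsSeparableAlgebra R A) :
    IsSeparableAlgebra k (k ⊗[R] A) := by
  refine sep_of_span (Algebra.TensorProduct.includeRight : A →ₐ[R] k ⊗[R] A) ?_ h
  rw [eq_top_iff]
  rintro x -
  induction x with
  | zero => exact zero_mem _
  | add x y hx hy => exact add_mem hx hy
  | tmul c a =>
    have : c ⊗ₜ[R] a = c • ((1 : k) ⊗ₜ[R] a) := by simp [TensorProduct.smul_tmul']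
    rw [this]
    exact Submodule.smul_mem _ _ (Submodule.subset_span ⟨a, rfl⟩)

lemma sep_restrict {R : Type*} (S : Type*) {A : Type*} [CommRing R] [CommRing S] [Ring A]
    [Algebra R A] [Algebra R S] [Algebra S A] [IsScalarTower R S A]
    (h : IsSeparableAlgebra R A) : IsSeparableAlgebra S A := by
  refine sep_of_span (AlgHom.id R A) ?_ h
  rw [eq_top_iff]
  exact fun x _ => Submodule.subset_span ⟨x, rfl⟩

lemma semisimple_of_sep {k B : Type*} [Field k] [Ring B] [Algebra k B]
    (h : IsSeparableAlgebra k B) : IsSemisimpleRing B := by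
  obtain ⟨s, h1, h2⟩ := sep_iff h
  have : ComplementedLattice (Submodule B B) := by
    constructor
    intro N
    obtain ⟨p, hp⟩ := LinearMap.exists_leftInverse_of_injective
      (N.restrictScalars k).subtype (Submodule.ker_subtype _)
    let q : B →ₗ[k] B := (N.restrictScalars k).subtype ∘ₗ p
    have hqN : ∀ b, q b ∈ N := fun b => (p b).2
    have hq : ∀ b ∈ N, q b = b := fun b hb =>
      congrArg Subtype.val (LinearMap.congr_fun hp ⟨b, hb⟩)
    let P0 : B →ₗ[B] B :=
      { toFun := fun m => ∑ i ∈ s, i.1 * q (i.2 * m)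
        map_add' := fun m m' => by
          simp only [mul_add, map_add, Finset.sum_add_distrib]
        map_smul' := fun b m => by
          let F : B →ₗ[k] B →ₗ[k] B := LinearMap.mk₂ k (fun x y => x * q (y * m))
            (fun x y z => by simp [add_mul]) (fun c x y => by simp)
            (fun x y z => by simp [add_mul, mul_add]) (fun c x y => by simp)
          have := congrArg (TensorProduct.lift F) (h2 b)
          simp only [map_sum, TensorProduct.lift.tmul] at this
          simp only [F, LinearMap.mk₂_apply] at this
          simpa [Finset.mul_sum, mul_assoc] using this.symm }
    let P : B →ₗ[B] N := P0.codRestrict N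
      (fun m => N.sum_mem fun i _ => N.smul_mem i.1 (hqN _))
    have hP : ∀ x : N, P x = x := by
      intro x
      apply Subtype.ext
      change ∑ i ∈ s, i.1 * q (i.2 * (x : B)) = x
      have hx : ∀ b : B, q (b * (x:B)) = b * x := fun b => hq _ (N.smul_mem b x.2)
      simp only [hx, ← mul_assoc, ← Finset.sum_mul, h1, one_mul]
    exact ⟨_, LinearMap.isCompl_of_proj hP⟩
  exact { toComplementedLattice := this }

lemma central_nilpotent {B : Type*} [Ring B] [IsSemisimpleRing B] (z : B)
    (hz : ∀ b, b * z = z * b) (hn : IsNilpotent z) : z = 0 := by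
  obtain ⟨J, hJ⟩ := exists_isCompl (Submodule.span B {z})
  have h1 : (1 : B) ∈ Submodule.span B {z} ⊔ J := by rw [hJ.sup_eq_top]; trivial
  obtain ⟨u, hu, j, hj, huj⟩ := Submodule.mem_sup.1 h1
  obtain ⟨b, rfl⟩ := Submodule.mem_span_singleton.1 hu
  have hzj : z * j = 0 := by
    have hm : z * j ∈ Submodule.span B {z} ⊓ J := by
      refine ⟨?_, J.smul_mem z hj⟩
      have : z * j = (1 - z * b) • z := by
        have h3 : z * (b • z + j) = z := by rw [huj, mul_one]
        rw [mul_add] at h3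
        rw [smul_eq_mul, sub_mul, one_mul, mul_assoc, eq_sub_iff_add_eq, add_comm]
        exact h3
      rw [this]
      exact Submodule.smul_mem _ _ (Submodule.mem_span_singleton_self z)
    rw [hJ.inf_eq_bot] at hm
    simpa using hm
  have hb : z = b * z ^ 2 := by
    have h3 : z * (b • z + j) = z := by rw [huj, mul_one]
    rw [mul_add, hzj, add_zero, smul_eq_mul, ← mul_assoc, ← hz b, mul_assoc, ← sq] at h3
    exact h3.symm
  have hk : ∀ k : ℕ, z = b ^ k * z ^ (k + 1) := by
    intro k
    induction k with
    | zero => simp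
    | succ k ih =>
      calc z = b ^ k * z ^ (k + 1) := ih
        _ = b ^ k * (z * z ^ k) := by rw [pow_succ']
        _ = b ^ k * ((b * z ^ 2) * z ^ k) := by rw [← hb]
        _ = _ := by rw [pow_succ b, mul_assoc, mul_assoc, ← pow_add]; congr 3; ring
  obtain ⟨N, hN⟩ := hn
  rw [hk N, pow_succ, hN, zero_mul, mul_zero]

/-- The central projection. -/
lemma exists_proj {R S A : Type*} [CommRing R] [CommRing S] [Ring A]
    [Algebra R S] [Algebra R A] [Algebra S A] [IsScalarTower R S A]
    (hinj : Function.Injective (algebraMap S A))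
    (hc : ∀ z : A, (∀ b, b * z = z * b) → z ∈ (algebraMap S A).range)
    (h : IsSeparableAlgebra R A) :
    ∃ π : A →ₗ[S] S, ∀ s : S, π (algebraMap S A s) = s := by
  obtain ⟨s, h1, h2⟩ := sep_iff h
  choose f hf using fun a => hc (∑ i ∈ s, i.1 * a * i.2) (fun b => sep_sandwich h2 a b)
  refine ⟨⟨⟨f, ?_⟩, ?_⟩, ?_⟩
  · intro a b
    apply hinj
    rw [map_add, hf, hf, hf, ← Finset.sum_add_distrib]
    simp only [mul_add, add_mul]
  · intro c a
    apply hinj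
    simp only [RingHom.id_apply]
    rw [smul_eq_mul, map_mul, hf, hf, Finset.mul_sum]
    apply Finset.sum_congr rfl
    intro i _
    rw [mul_smul_comm, smul_mul_assoc, Algebra.smul_def]
  · intro c
    apply hinj
    change algebraMap S A (f (algebraMap S A c)) = _
    rw [hf]
    have : ∀ i ∈ s, i.1 * (algebraMap S A c) * i.2 = (algebraMap S A c) * (i.1 * i.2) := by
      intro i _
      rw [← Algebra.commutes c i.1, mul_assoc]
    rw [Finset.sum_congr rfl this, ← Finset.mul_sum, h1, mul_one]

lemma central_fiber {S k A : Type*} [CommRing S] [Field k] [Ring A] [Algebra S A] [Algebra S k]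
    (hc : ∀ z : A, (∀ b, b * z = z * b) → z ∈ (algebraMap S A).range)
    (h : IsSeparableAlgebra S A) (z : k ⊗[S] A) (hz : ∀ b, b * z = z * b) :
    ∃ c : k, z = algebraMap k _ c := by
  obtain ⟨s, h1, h2⟩ := sep_iff h
  have key : ∀ z : k ⊗[S] A, ∑ i ∈ s, ((1 : k) ⊗ₜ[S] i.1) * z * (1 ⊗ₜ i.2) ∈
      (algebraMap k (k ⊗[S] A)).range := by
    intro z
    induction z with
    | zero => simp
    | add x y hx hy =>
      simp only [mul_add, add_mul, Finset.sum_add_distrib]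
      exact add_mem hx hy
    | tmul c a =>
      simp only [Algebra.TensorProduct.tmul_mul_tmul, one_mul, mul_one]
      rw [← TensorProduct.tmul_sum]
      obtain ⟨t, ht⟩ := hc (∑ i ∈ s, i.1 * a * i.2) (fun b => sep_sandwich h2 a b)
      rw [← ht, Algebra.algebraMap_eq_smul_one, ← TensorProduct.smul_tmul]
      exact ⟨t • c, rfl⟩
  obtain ⟨c, hc'⟩ := key z
  refine ⟨c, ?_⟩
  rw [hc']
  have : ∀ i ∈ s, ((1 : k) ⊗ₜ[S] i.1) * z * (1 ⊗ₜ i.2) = z * (1 ⊗ₜ (i.1 * i.2)) := by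
    intro i _
    rw [hz, mul_assoc, Algebra.TensorProduct.tmul_mul_tmul, one_mul]
  rw [Finset.sum_congr rfl this, ← Finset.mul_sum, ← TensorProduct.tmul_sum, h1]
  exact (mul_one z).symm

lemma simple_of_central {k B : Type*} [Field k] [Ring B] [Nontrivial B] [Algebra k B]
    [IsSemisimpleRing B] (hc : ∀ z : B, (∀ b, b * z = z * b) → ∃ c : k, z = algebraMap k _ c) :
    IsSimpleRing B := by
  obtain ⟨r, D, d, _, _, hd, ⟨φ⟩⟩ := IsSemisimpleRing.exists_algEquiv_pi_matrix_divisionRing k B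
  have hsub : Subsingleton (Fin r) := by
    constructor
    intro i j
    by_contra hij
    let z : ∀ i, Matrix (Fin (d i)) (Fin (d i)) (D i) := Pi.single i 1
    have hz : ∀ b, b * z = z * b := by
      intro b
      ext1 l
      by_cases hl : l = i
      · subst hl; simp [z]
      · simp [z, hl]
    obtain ⟨c, hcz⟩ := hc (φ.symm z) (fun b => by
      apply φ.injective
      simp only [map_mul, AlgEquiv.apply_symm_apply]
      exact hz _)
    have h1 : z = algebraMap k _ c := by
      rw [← φ.apply_symm_apply z, hcz, AlgEquiv.commutes]
    have hc0 : c = 0 := by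
      have h2 := congrFun h1 j
      have h3 : z j = 0 := by simp [z, Ne.symm hij]
      rw [h3] at h2
      have h4 : algebraMap k (Matrix (Fin (d j)) (Fin (d j)) (D j)) c = 0 := h2.symm
      exact (map_eq_zero _).1 h4
    rw [hc0, map_zero] at h1
    have h5 := congrFun h1 i
    simp [z] at h5
  have hne : Nonempty (Fin r) := by
    by_contra hne
    rw [not_nonempty_iff] at hne
    have : Subsingleton B := φ.toEquiv.subsingleton
    exact not_subsingleton B this
  obtain ⟨i0⟩ := hne
  let u : Unique (Fin r) := ⟨⟨i0⟩, fun a => Subsingleton.elim _ _⟩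
  let e := φ.toRingEquiv.trans (RingEquiv.piUnique (fun i => Matrix (Fin (d i)) (Fin (d i)) (D i)))
  exact IsSimpleRing.of_ringEquiv e.symm inferInstance

lemma simple_fiber {S k A : Type*} [CommRing S] [Field k] [Ring A] [Algebra S A] [Algebra S k]
    (hinj : Function.Injective (algebraMap S A))
    (hc : ∀ z : A, (∀ b, b * z = z * b) → z ∈ (algebraMap S A).range)
    (h : IsSeparableAlgebra S A) : IsSimpleRing (k ⊗[S] A) := by
  have hss : IsSemisimpleRing (k ⊗[S] A) := semisimple_of_sep (sep_baseChange k h)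
  obtain ⟨π, hπ⟩ := exists_proj hinj hc h
  have : Nontrivial (k ⊗[S] A) := by
    refine nontrivial_of_ne 1 0 fun h0 => ?_
    have h2 := congrArg (LinearMap.lTensor k π) h0
    rw [map_zero, Algebra.TensorProduct.one_def, LinearMap.lTensor_tmul] at h2
    have h3 : π 1 = 1 := by simpa using hπ 1
    rw [h3] at h2
    have := congrArg (TensorProduct.rid S k) h2
    simp at this
  exact simple_of_central (central_fiber hc h)

lemma center_facts {R S A : Type} [CommRing R] [CommRing S] [Ring A]
    [Algebra R S] [Algebra R A] [Algebra S A] [IsScalarTower R S A]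
    (hinj : Function.Injective (algebraMap S A))
    (hc : ∀ z : A, (∀ b, b * z = z * b) → z ∈ (algebraMap S A).range)
    (h : IsSeparableAlgebra R A) [Module.Finite R A] [Module.Projective R A] :
    Module.Finite R S ∧ Module.Projective R S ∧ Algebra.Etale R S ∧ Module.Finite S A ∧
      Module.Projective S A := by
  obtain ⟨π, hπ⟩ := exists_proj hinj hc h
  have hsurj : Function.Surjective (π.restrictScalars R) := fun s => ⟨_, hπ s⟩
  have h1 : Module.Finite R S := Module.Finite.of_surjective _ hsurj
  have h2 : Module.Projective R S := Module.Projective.of_split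
    (IsScalarTower.toAlgHom R S A).toLinearMap (π.restrictScalars R) (by ext s; exact hπ s)
  have h3 : Module.Finite S A := Module.Finite.of_restrictScalars_finite R S A
  have h4 : Algebra.FormallyUnramified R S := by
    apply unramified_of_fibers
    intro K _ _ _
    have hss : IsSemisimpleRing (K ⊗[R] A) := semisimple_of_sep (sep_baseChange K h)
    constructor
    intro t ht
    let ι : K ⊗[R] S →ₐ[K] K ⊗[R] A :=
      Algebra.TensorProduct.map (AlgHom.id K K) (IsScalarTower.toAlgHom R S A)
    have hι : ∀ t, LinearMap.lTensor K (π.restrictScalars R) (ι t) = t := by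
      intro t
      induction t with
      | zero => simp
      | add x y hx hy => rw [map_add, map_add, hx, hy]
      | tmul x y => simp [ι, hπ]
    have hcen : ∀ t b, b * ι t = ι t * b := by
      intro t b
      induction t with
      | zero => simp
      | add x y hx hy => rw [map_add, mul_add, add_mul, hx, hy]
      | tmul x y =>
        induction b with
        | zero => simp
        | add u v hu hv => rw [mul_add, add_mul, hu, hv]
        | tmul u v => simp [ι, mul_comm, Algebra.commutes]
    have h0 : ι t = 0 := central_nilpotent _ (hcen t) (ht.map ι)
    rw [← hι t, h0, map_zero]
  have hfp0 : Module.FinitePresentation R S := Module.finitePresentation_of_projective R S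
  have hfp : Algebra.FinitePresentation R S := inferInstance
  have h5 : Algebra.Etale R S := Algebra.Etale.of_formallyUnramified_of_flat
  have h6 : Module.Projective S A := Algebra.FormallyUnramified.projective_of_restrictScalars R S A
  exact ⟨h1, h2, h5, h3, h6⟩

lemma finite_maxSpec {R S : Type} [CommRing R] [CommRing S] [Algebra R S] [Module.Finite R S]
    (h : IsSemilocalRing R) : Finite (MaximalSpectrum S) := by
  have : Set.Finite {I : Ideal S | I.IsMaximal} := by
    refine Set.Finite.subset (h.biUnion (t := fun m => m.primesOver S)
      fun m _ => Algebra.QuasiFinite.finite_primesOver m) ?_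
    intro I hI
    have hI' : I.IsMaximal := hI
    simp only [Set.mem_iUnion]
    exact ⟨I.under R, Ideal.isMaximal_comap_of_isIntegral_of_isMaximal I, hI'.isPrime, ⟨rfl⟩⟩
  have := this.to_subtype
  exact Finite.of_injective (fun x : MaximalSpectrum S => (⟨x.1, x.2⟩ : {I : Ideal S | I.IsMaximal}))
    (fun x y hxy => MaximalSpectrum.ext (congrArg Subtype.val hxy))

open TensorProduct Polynomial

/-- A good pair. -/
def GoodPair (k : Type*) [Field k] {B : Type*} [Ring B] [Algebra k B] (n : ℕ) (a v : B)
    (f : k[X]) : Prop :=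
  f.Monic ∧ f.natDegree = n ∧ f.Separable ∧ aeval a f = 0 ∧
    LinearIndependent k (fun p : Fin n × Fin n => a ^ (p.1 : ℕ) * v * a ^ (p.2 : ℕ))

lemma GoodPair.map {k : Type*} [Field k] {B B' : Type*} [Ring B] [Algebra k B] [Ring B']
    [Algebra k B'] {n : ℕ} {a v : B} {f : k[X]} (h : GoodPair k n a v f) (φ : B ≃ₐ[k] B') :
    GoodPair k n (φ a) (φ v) f := by
  obtain ⟨h1, h2, h3, h4, h5⟩ := h
  refine ⟨h1, h2, h3, ?_, ?_⟩
  · rw [aeval_algHom_apply, h4, map_zero]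
  · have := h5.map' φ.toLinearMap (LinearMap.ker_eq_bot.2 φ.injective)
    have h6 : (φ.toLinearMap ∘ fun p : Fin n × Fin n => a ^ (p.1 : ℕ) * v * a ^ (p.2 : ℕ)) =
      fun p : Fin n × Fin n => φ a ^ (p.1 : ℕ) * φ v * φ a ^ (p.2 : ℕ) := by
      ext p; simp
    rw [h6] at this
    exact this

lemma separable_iff_resultant {R : Type*} [CommRing R] [Nontrivial R] {f : R[X]} (hf : f.Monic)
    {n : ℕ} (hn : f.natDegree = n) :
    f.Separable ↔ IsUnit (f.resultant (derivative f) n n) := by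
  have hd : (derivative f).natDegree ≤ n := (natDegree_derivative_le f).trans (by omega)
  obtain ⟨k, hk⟩ := Nat.exists_eq_add_of_le hd
  have : f.resultant (derivative f) n n = f.resultant (derivative f) := by
    have h2 := resultant_add_right_deg f (derivative f) n (derivative f).natDegree k le_rfl
    rw [← hk] at h2
    rw [h2, ← hn]
    simp [hf.coeff_natDegree]
  rw [this, isUnit_resultant_iff_isCoprime hf]
  rfl

lemma exists_separable (K : Type*) [Field K] (n : ℕ) (hn : 1 ≤ n) :
    ∃ f : K[X], f.Monic ∧ f.natDegree = n ∧ f.Separable := by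
  by_cases h : (n : K) = 0
  · have h2 : 1 < n := by
      rcases hn.lt_or_eq with h1 | h1
      · exact h1
      · rw [← h1] at h; simp at h
    have hdeg : (X : K[X]).natDegree < n := by simpa using h2
    refine ⟨X ^ n - X, ?_, ?_, ?_⟩
    · exact monic_X_pow_sub (by rw [degree_X]; exact_mod_cast h2)
    · rw [natDegree_sub_eq_left_of_natDegree_lt] <;> simp [h2]
    · refine ⟨0, -1, ?_⟩
      simp [derivative_X_pow, h]
  · refine ⟨X ^ n - C 1, monic_X_pow_sub_C 1 (by omega), natDegree_X_pow_sub_C,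
      separable_X_pow_sub_C 1 h one_ne_zero⟩

lemma split_aux {K L : Type*} [Field K] [CommRing L] [Algebra K L] {n : ℕ} (x : L)
    (b : Module.Basis (Fin n) K L) (hb : ∀ i, b i = x ^ (i : ℕ)) (hn : 0 < n) (c : Fin n → K)
    (h : ∀ p : L, b.coord ⟨n - 1, by omega⟩ (∑ j, c j • x ^ (j : ℕ) * p) = 0) : c = 0 := by
  have key : ∀ m : ℕ, ∀ j : Fin n, (j : ℕ) + m = n - 1 → c j = 0 := by
    intro m
    induction m using Nat.strong_induction_on with
    | _ m ih =>
      intro j hj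
      have h1 := h (x ^ m)
      rw [map_sum, Finset.sum_eq_single j] at h1
      · rw [smul_mul_assoc, ← pow_add, map_smul, hj] at h1
        have h2 : x ^ (n - 1) = b ⟨n - 1, by omega⟩ := by rw [hb]
        rw [h2] at h1
        simpa using h1
      · intro i _ hij
        rw [smul_mul_assoc, ← pow_add, map_smul]
        rcases lt_trichotomy ((i : ℕ) + m) (n - 1) with hlt | heq | hgt
        · have h2 : x ^ ((i : ℕ) + m) = b ⟨i + m, by omega⟩ := by rw [hb]
          rw [h2]
          have : (⟨i + m, by omega⟩ : Fin n) ≠ ⟨n - 1, by omega⟩ := by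
            intro h3; simp at h3; omega
          simp [Module.Basis.coord_apply, Module.Basis.repr_self, Finsupp.single_apply]
          intro h3; omega
        · exfalso; apply hij; ext; omega
        · rw [ih (n - 1 - i) (by omega) i (by omega), zero_smul]
      · simp
  ext j
  exact key (n - 1 - j) j (by omega)

lemma split_goodPair (K : Type*) [Field K] (n : ℕ) (hn : 1 ≤ n) :
    ∃ (a v : Matrix (Fin n) (Fin n) K) (f : K[X]), GoodPair K n a v f := by
  obtain ⟨f, hf, hdeg, hsep⟩ := exists_separable K n hn
  let x : (AdjoinRoot f) := AdjoinRoot.root f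
  have hb0 : ∃ b : Module.Basis (Fin n) K (AdjoinRoot f), ∀ i, b i = x ^ (i : ℕ) := by
    subst hdeg
    refine ⟨(AdjoinRoot.powerBasis' hf).basis.reindex
      (finCongr (AdjoinRoot.powerBasis'_dim hf)), fun i => ?_⟩
    rw [Module.Basis.reindex_apply, PowerBasis.basis_eq_pow, AdjoinRoot.powerBasis'_gen]
    rfl
  obtain ⟨b, hb⟩ := hb0
  let φ := b.coord ⟨n - 1, by omega⟩
  let a : Module.End K (AdjoinRoot f) := Algebra.lmul K (AdjoinRoot f) x
  let v : Module.End K (AdjoinRoot f) := φ.smulRight (1 : (AdjoinRoot f))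
  have hG : GoodPair K n a v f := by
    refine ⟨hf, hdeg, hsep, ?_, ?_⟩
    · rw [aeval_algHom_apply, AdjoinRoot.aeval_eq, AdjoinRoot.mk_self, map_zero]
    · rw [Fintype.linearIndependent_iff]
      intro c hc
      have happ : ∀ (i j : ℕ) (p : (AdjoinRoot f)), (a ^ i * v * a ^ j) p = φ (x ^ j * p) • x ^ i := by
        intro i j p
        simp only [a, ← map_pow, Module.End.mul_apply, v, LinearMap.smulRight_apply, map_smul]
        simp
      have h1 : ∀ (p : (AdjoinRoot f)) (i : Fin n), φ (∑ j, c (i, j) • x ^ (j : ℕ) * p) = 0 := by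
        intro p
        have h2 := LinearMap.congr_fun hc p
        simp only [LinearMap.sum_apply, LinearMap.smul_apply, happ, LinearMap.zero_apply] at h2
        rw [Fintype.sum_prod_type] at h2
        have h3 : ∑ i : Fin n, (φ (∑ j, c (i, j) • x ^ (j : ℕ) * p)) • b i = 0 := by
          rw [← h2]
          apply Finset.sum_congr rfl
          intro i _
          rw [map_sum, Finset.sum_smul]
          apply Finset.sum_congr rfl
          intro j _
          rw [smul_mul_assoc, map_smul, smul_assoc, hb]
        exact (Fintype.linearIndependent_iff.1 b.linearIndependent) _ h3
      rintro ⟨i, j⟩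
      exact congrFun (split_aux x b hb (by omega) (fun j => c (i, j)) (fun p => h1 p i)) j
  exact ⟨_, _, f, hG.map (LinearMap.toMatrixAlgEquiv b)⟩

lemma goodPair_finite {k B : Type*} [Field k] [Finite k] [Ring B] [Algebra k B] [IsSimpleRing B]
    [Module.Finite k B] (hc : ∀ z : B, (∀ b, b * z = z * b) → ∃ c : k, z = algebraMap k _ c)
    (n : ℕ) (hn : 1 ≤ n) (hr : Module.finrank k B = n ^ 2) :
    ∃ (a v : B) (f : k[X]), GoodPair k n a v f := by
  have : IsArtinianRing B := IsArtinianRing.of_finite k B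
  obtain ⟨r, hr0, D, _, _, _, ⟨φ⟩⟩ := IsSimpleRing.exists_algEquiv_matrix_divisionRing_finite k B
  have : Finite D := Module.finite_of_finite k
  have hcomm : ∀ x y : D, x * y = y * x := fun x y => by
    letI := littleWedderburn D
    exact mul_comm x y
  have hbij : Function.Bijective (algebraMap k D) := by
    refine ⟨(algebraMap k D).injective, fun d => ?_⟩
    obtain ⟨c, hcz⟩ := hc (φ.symm (Matrix.diagonal fun _ => d)) (fun b => by
      apply φ.injective
      simp only [map_mul, AlgEquiv.apply_symm_apply]
      ext i j
      simp [Matrix.mul_diagonal, Matrix.diagonal_mul, hcomm])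
    refine ⟨c, ?_⟩
    have h1 := congrArg φ hcz
    rw [AlgEquiv.apply_symm_apply, AlgEquiv.commutes] at h1
    have h2 := congrFun (congrFun h1 0) 0
    simpa [Matrix.algebraMap_matrix_apply] using h2.symm
  let e : k ≃ₐ[k] D := AlgEquiv.ofBijective (Algebra.ofId k D) hbij
  let Φ : B ≃ₐ[k] Matrix (Fin r) (Fin r) k := φ.trans e.symm.mapMatrix
  have hrn : r = n := by
    have := Φ.toLinearEquiv.finrank_eq
    rw [hr, Module.finrank_matrix] at this
    simp at this
    rw [← sq] at this
    exact (Nat.pow_left_injective (n := 2) (by omega) this).symm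
  subst hrn
  obtain ⟨a, v, f, h⟩ := split_goodPair k r hn
  exact ⟨_, _, f, h.map Φ.symm⟩

open TensorProduct Polynomial

/-- flatten a matrix -/
noncomputable def flat (K : Type*) [CommRing K] (n : ℕ) :
    Matrix (Fin n) (Fin n) K →ₗ[K] (Fin n × Fin n → K) where
  toFun M p := M p.1 p.2
  map_add' _ _ := rfl
  map_smul' _ _ := rfl

lemma flat_inj (K : Type*) [CommRing K] (n : ℕ) : (flat K n).ker = ⊥ := by
  rw [LinearMap.ker_eq_bot]
  intro M N h
  ext i j
  exact congrFun h (i, j)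

/-- The generic matrix -/
noncomputable def bigMat {P : Type*} [CommRing P] {n : ℕ} (X Y : Matrix (Fin n) (Fin n) P) :
    Matrix (Fin n × Fin n) (Fin n × Fin n) P :=
  fun p q => (X ^ (p.1 : ℕ) * Y * X ^ (p.2 : ℕ)) q.1 q.2

lemma bigMat_map {P P' : Type*} [CommRing P] [CommRing P'] (φ : P →+* P') {n : ℕ}
    (X Y : Matrix (Fin n) (Fin n) P) :
    (bigMat X Y).map φ = bigMat (X.map φ) (Y.map φ) := by
  ext p q
  have : ((X ^ (p.1 : ℕ) * Y * X ^ (p.2 : ℕ)).map φ) =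
      (X.map φ) ^ (p.1 : ℕ) * (Y.map φ) * (X.map φ) ^ (p.2 : ℕ) := by
    simp only [← RingHom.mapMatrix_apply, map_mul, map_pow]
  simp only [bigMat, ← this, Matrix.map_apply]

lemma bigMat_det {K : Type*} [Field K] {n : ℕ} (X Y : Matrix (Fin n) (Fin n) K) :
    LinearIndependent K (fun p : Fin n × Fin n => X ^ (p.1 : ℕ) * Y * X ^ (p.2 : ℕ)) ↔
      (bigMat X Y).det ≠ 0 := by
  rw [← isUnit_iff_ne_zero, ← Matrix.isUnit_iff_isUnit_det,
    ← Matrix.linearIndependent_rows_iff_isUnit, ← LinearMap.linearIndependent_iff _ (flat_inj K n)]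
  rfl

lemma charpoly_eq_of_goodPair {K : Type*} [Field K] {n : ℕ} (hn : 1 ≤ n)
    {X Y : Matrix (Fin n) (Fin n) K} {f : K[X]} (h : GoodPair K n X Y f) : X.charpoly = f := by
  obtain ⟨h1, h2, h3, h4, h5⟩ := h
  have hnt : Nonempty (Fin n) := ⟨⟨0, hn⟩⟩
  by_contra hne
  have hd : (X.charpoly - f).degree < n := by
    have := degree_sub_lt (p := X.charpoly) (q := f) ?_ X.charpoly_monic.ne_zero ?_
    · rwa [Matrix.charpoly_degree_eq_dim, Fintype.card_fin] at this
    · rw [Matrix.charpoly_degree_eq_dim, Fintype.card_fin, degree_eq_natDegree h1.ne_zero, h2]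
    · rw [X.charpoly_monic, h1]
  set g := X.charpoly - f with hg
  have hgX : aeval X g = 0 := by rw [hg, map_sub, h4, Matrix.aeval_self_charpoly, sub_zero]
  have hsum : ∑ i : Fin n, g.coeff i • X ^ (i : ℕ) = 0 := by
    rw [← hgX, aeval_eq_sum_range' (n := n)]
    · rw [Finset.sum_range]
    · exact (natDegree_lt_iff_degree_lt (sub_ne_zero.2 hne)).2 hd
  have hLI := h5.comp (fun i : Fin n => (i, (⟨0, hn⟩ : Fin n))) (fun i j hij => by simpa using hij)
  rw [Fintype.linearIndependent_iff] at hLI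
  have h6 := hLI (fun i => g.coeff i) (by
    simp only [Function.comp_apply, pow_zero, mul_one, ← smul_mul_assoc]
    rw [← Finset.sum_mul, hsum, zero_mul])
  apply hne
  rw [← sub_eq_zero]
  ext i
  by_cases hi : i < n
  · exact h6 ⟨i, hi⟩
  · rw [coeff_eq_zero_of_degree_lt (lt_of_lt_of_le hd (by exact_mod_cast not_lt.1 hi))]
    simp

lemma goodPair_infinite {k B : Type*} [Field k] [Infinite k] [Ring B] [Algebra k B]
    [Module.Finite k B] (K : Type*) [Field K] [IsAlgClosed K] [Algebra k K]
    (hs : IsSimpleRing (K ⊗[k] B))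
    (n : ℕ) (hn : 1 ≤ n) (hr : Module.finrank k B = n ^ 2) :
    ∃ (a v : B) (f : k[X]), GoodPair k n a v f := by
  classical
  obtain ⟨r, hr0, ⟨ψ⟩⟩ := IsSimpleRing.exists_algEquiv_matrix_of_isAlgClosed K (K ⊗[k] B)
  have hrn : r = n := by
    have := ψ.toLinearEquiv.finrank_eq
    rw [Module.finrank_baseChange, hr, Module.finrank_matrix] at this
    simp at this
    rw [← sq] at this
    exact (Nat.pow_left_injective (n := 2) (by omega) this).symm
  subst hrn
  let N := Module.finrank k B
  let b : Module.Basis (Fin N) k B := Module.finBasis k B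
  let bK : Module.Basis (Fin N) K (Matrix (Fin r) (Fin r) K) :=
    (b.baseChange K).map ψ.toLinearEquiv
  have hbK : ∀ j, bK j = ψ (1 ⊗ₜ b j) := fun j => by simp [bK]
  let P := MvPolynomial (Fin N ⊕ Fin N) K
  let X : Matrix (Fin r) (Fin r) P := ∑ j, (MvPolynomial.X (Sum.inl j) : P) • (bK j).map MvPolynomial.C
  let Y : Matrix (Fin r) (Fin r) P := ∑ j, (MvPolynomial.X (Sum.inr j) : P) • (bK j).map MvPolynomial.C
  have hX : ∀ c : Fin N ⊕ Fin N → K, X.map (MvPolynomial.eval c) = ∑ j, c (Sum.inl j) • bK j := by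
    intro c
    ext i j
    simp [X, Matrix.sum_apply]
  have hY : ∀ c : Fin N ⊕ Fin N → K, Y.map (MvPolynomial.eval c) = ∑ j, c (Sum.inr j) • bK j := by
    intro c
    ext i j
    simp [Y, Matrix.sum_apply]
  let Q : P := X.charpoly.resultant (derivative X.charpoly) r r * (bigMat X Y).det
  have hQ : ∀ c, MvPolynomial.eval c Q =
      (X.map (MvPolynomial.eval c)).charpoly.resultant
        (derivative (X.map (MvPolynomial.eval c)).charpoly) r r *
      (bigMat (X.map (MvPolynomial.eval c)) (Y.map (MvPolynomial.eval c))).det := by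
    intro c
    rw [map_mul, ← resultant_map_map, ← derivative_map, ← Matrix.charpoly_map, RingHom.map_det,
      RingHom.mapMatrix_apply, bigMat_map]
  have hsepc : ∀ M : Matrix (Fin r) (Fin r) K, M.charpoly.Separable ↔
      M.charpoly.resultant (derivative M.charpoly) r r ≠ 0 := by
    intro M
    rw [separable_iff_resultant M.charpoly_monic (n := r) (by simp [Matrix.charpoly_natDegree_eq_dim]),
      isUnit_iff_ne_zero]
  have hQ0 : Q ≠ 0 := by
    obtain ⟨a, v, f, hG⟩ := split_goodPair K r hn
    intro h0
    let c : Fin N ⊕ Fin N → K := Sum.elim (fun j => bK.repr a j) (fun j => bK.repr v j)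
    have h1 := hQ c
    have hXa : X.map (MvPolynomial.eval c) = a := by
      rw [hX]; exact bK.sum_repr a
    have hYv : Y.map (MvPolynomial.eval c) = v := by
      rw [hY]; exact bK.sum_repr v
    rw [h0, map_zero, hXa, hYv] at h1
    have h2 := charpoly_eq_of_goodPair hn hG
    refine mul_ne_zero ?_ ?_ h1.symm
    · rw [← hsepc, h2]; exact hG.2.2.1
    · rw [← bigMat_det]; exact hG.2.2.2.2
  have hex : ∃ c' : Fin N ⊕ Fin N → k, MvPolynomial.eval (fun i => algebraMap k K (c' i)) Q ≠ 0 := by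
    by_contra hcon
    push Not at hcon
    apply hQ0
    apply MvPolynomial.funext_set (fun _ => Set.range (algebraMap k K))
    · intro _
      exact Set.infinite_range_of_injective (algebraMap k K).injective
    · intro x hx
      choose c' hc' using fun i => hx i trivial
      have : x = fun i => algebraMap k K (c' i) := funext fun i => (hc' i).symm
      rw [this, hcon, map_zero]
  obtain ⟨c', hc'⟩ := hex
  let a : B := ∑ j, c' (Sum.inl j) • b j
  let v : B := ∑ j, c' (Sum.inr j) • b j
  let ι : B →ₐ[k] Matrix (Fin r) (Fin r) K :=
    (ψ.toAlgHom.restrictScalars k).comp Algebra.TensorProduct.includeRight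
  have hι : ∀ x, ι x = ψ (1 ⊗ₜ x) := fun x => rfl
  have hιinj : Function.Injective ι := by
    have h1 : Function.Injective (fun x : B => (1 : K) ⊗ₜ[k] x) :=
      Algebra.TensorProduct.includeRight_injective (algebraMap k K).injective
    exact ψ.injective.comp h1
  have ha : ι a = X.map (MvPolynomial.eval (fun i => algebraMap k K (c' i))) := by
    rw [hX, map_sum]
    apply Finset.sum_congr rfl
    intro j _
    rw [map_smul, hι, hbK, algebraMap_smul]
  have hv : ι v = Y.map (MvPolynomial.eval (fun i => algebraMap k K (c' i))) := by
    rw [hY, map_sum]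
    apply Finset.sum_congr rfl
    intro j _
    rw [map_smul, hι, hbK, algebraMap_smul]
  rw [hQ, ← ha, ← hv] at hc'
  have hsep := (hsepc _).2 (left_ne_zero_of_mul hc')
  have hLIK := (bigMat_det _ _).2 (right_ne_zero_of_mul hc')
  have hLI : LinearIndependent k
      (fun p : Fin r × Fin r => a ^ (p.1 : ℕ) * v * a ^ (p.2 : ℕ)) := by
    apply LinearIndependent.of_comp ι.toLinearMap
    have h1 := hLIK.restrict_scalars (R := k) (by
      intro x y hxy
      simp only [Algebra.smul_def, mul_one] at hxy
      exact (algebraMap k K).injective hxy)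
    have h2 : (ι.toLinearMap ∘ fun p : Fin r × Fin r => a ^ (p.1 : ℕ) * v * a ^ (p.2 : ℕ)) =
        fun p => (ι a) ^ (p.1 : ℕ) * ι v * (ι a) ^ (p.2 : ℕ) := by
      ext1 p; simp
    rw [h2]
    exact h1
  have hne : Nonempty (Fin r × Fin r) := ⟨(⟨0, hn⟩, ⟨0, hn⟩)⟩
  let bb := basisOfLinearIndependentOfCardEqFinrank hLI (by rw [hr]; simp [sq])
  have hbb : ∀ p, bb p = a ^ (p.1 : ℕ) * v * a ^ (p.2 : ℕ) := fun p => by simp [bb]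
  have hlift : (ι a).charpoly ∈ lifts (algebraMap k K) := by
    rw [lifts_iff_coeff_lifts]
    intro i
    have hdeg : (ι a).charpoly.natDegree = r := by simp [Matrix.charpoly_natDegree_eq_dim]
    rcases lt_trichotomy i r with hi | hi | hi
    · have h1 : ∑ p, (algebraMap k K (bb.repr (a ^ r * v) p)) •
          ((ι a) ^ (p.1 : ℕ) * ι v * (ι a) ^ (p.2 : ℕ)) = (ι a) ^ r * ι v := by
        have := congrArg ι (bb.sum_repr (a ^ r * v))
        rw [map_sum] at this
        simpa [hbb, algebraMap_smul] using this
      have h2 : ∑ p : Fin r × Fin r, (if p.2 = ⟨0, hn⟩ then -(ι a).charpoly.coeff p.1 else 0) •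
          ((ι a) ^ (p.1 : ℕ) * ι v * (ι a) ^ (p.2 : ℕ)) = (ι a) ^ r * ι v := by
        rw [Fintype.sum_prod_type]
        simp only [ite_smul, zero_smul, Finset.sum_ite_eq', Finset.mem_univ, if_true,
          pow_zero, mul_one, neg_smul]
        have h3 := Matrix.aeval_self_charpoly (ι a)
        rw [aeval_eq_sum_range, hdeg, Finset.sum_range_succ] at h3
        have h4 : (ι a).charpoly.coeff r = 1 := by
          have := (ι a).charpoly_monic.coeff_natDegree
          rwa [hdeg] at this
        rw [h4, one_smul] at h3
        rw [Finset.sum_neg_distrib]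
        simp only [← smul_mul_assoc]
        rw [← Finset.sum_mul, ← neg_mul]
        congr 1
        rw [Finset.sum_range] at h3
        exact neg_eq_of_add_eq_zero_right h3
      have h5 := Fintype.linearIndependent_iff.1 hLIK
        (fun p => algebraMap k K (bb.repr (a ^ r * v) p) -
          (if p.2 = ⟨0, hn⟩ then -(ι a).charpoly.coeff p.1 else 0)) (by
          simp only [sub_smul]
          rw [Finset.sum_sub_distrib, h1, h2, sub_self]) (⟨i, hi⟩, ⟨0, hn⟩)
      simp only [if_true] at h5
      refine ⟨- (bb.repr (a ^ r * v) (⟨i, hi⟩, ⟨0, hn⟩)), ?_⟩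
      rw [map_neg]
      linear_combination -h5
    · refine ⟨1, ?_⟩
      have := (ι a).charpoly_monic.coeff_natDegree
      rw [hdeg] at this
      rw [hi, this, map_one]
    · refine ⟨0, ?_⟩
      rw [coeff_eq_zero_of_natDegree_lt (by omega), map_zero]
  obtain ⟨f, hf1, hf2, hf3⟩ := lifts_and_natDegree_eq_and_monic hlift (ι a).charpoly_monic
  refine ⟨a, v, f, hf3, ?_, ?_, ?_, hLI⟩
  · rw [hf2]; simp [Matrix.charpoly_natDegree_eq_dim]
  · rw [← hf1] at hsep
    exact (separable_map _).1 hsep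
  · apply hιinj
    rw [map_zero, ← aeval_algHom_apply, ← aeval_map_algebraMap K, hf1, Matrix.aeval_self_charpoly]

lemma exists_goodPair {k B : Type*} [Field k] [Ring B] [Algebra k B] [IsSimpleRing B]
    [Module.Finite k B] (hc : ∀ z : B, (∀ b, b * z = z * b) → ∃ c : k, z = algebraMap k _ c)
    (hs : IsSimpleRing (AlgebraicClosure k ⊗[k] B))
    (n : ℕ) (hn : 1 ≤ n) (hr : Module.finrank k B = n ^ 2) :
    ∃ (a v : B) (f : k[X]), GoodPair k n a v f := by
  rcases finite_or_infinite k with h | h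
  · exact goodPair_finite hc n hn hr
  · exact goodPair_infinite (AlgebraicClosure k) hs n hn hr

open TensorProduct Polynomial

lemma goodPair_unique {K B : Type*} [Field K] [Ring B] [Algebra K B] {n : ℕ} (hn : 1 ≤ n)
    {X Y : B} {f g : K[X]} (h : GoodPair K n X Y f) (hg1 : g.Monic) (hg2 : g.natDegree = n)
    (hg3 : aeval X g = 0) : g = f := by
  obtain ⟨h1, h2, h3, h4, h5⟩ := h
  by_contra hne
  have hd : (g - f).degree < n := by
    have := degree_sub_lt_left (p := g) (q := f) ?_ hg1.ne_zero ?_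
    · rwa [degree_eq_natDegree hg1.ne_zero, hg2] at this
    · rw [degree_eq_natDegree hg1.ne_zero, hg2, degree_eq_natDegree h1.ne_zero, h2]
    · rw [hg1, h1]
  set q := g - f with hq
  have hgX : aeval X q = 0 := by rw [hq, map_sub, h4, hg3, sub_zero]
  have hsum : ∑ i : Fin n, q.coeff i • X ^ (i : ℕ) = 0 := by
    rw [← hgX, aeval_eq_sum_range' (n := n)]
    · rw [Finset.sum_range]
    · exact (natDegree_lt_iff_degree_lt (sub_ne_zero.2 hne)).2 hd
  have hLI := h5.comp (fun i : Fin n => (i, (⟨0, hn⟩ : Fin n))) (fun i j hij => by simpa using hij)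
  rw [Fintype.linearIndependent_iff] at hLI
  have h6 := hLI (fun i => q.coeff i) (by
    simp only [Function.comp_apply, pow_zero, mul_one, ← smul_mul_assoc]
    rw [← Finset.sum_mul, hsum, zero_mul])
  apply hne
  rw [← sub_eq_zero]
  ext i
  by_cases hi : i < n
  · exact h6 ⟨i, hi⟩
  · rw [coeff_eq_zero_of_degree_lt (lt_of_lt_of_le hd (by exact_mod_cast not_lt.1 hi))]
    simp

lemma nak_aux2 {T : Type*} [CommRing T] {M : Type*} [AddCommGroup M] [Module T M]
    (N P : Submodule T M) (hP : P.FG)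
    (h : ∀ m : Ideal T, m.IsMaximal → P ≤ N ⊔ m • P) : P ≤ N := by
  by_contra hN
  have hann : (N.colon (P : Set M)) ≠ ⊤ := by
    intro h1
    apply hN
    intro x hx
    have : (1 : T) ∈ N.colon (P : Set M) := by rw [h1]; trivial
    simpa using Submodule.mem_colon.1 this x hx
  obtain ⟨m, hm, hle⟩ := Ideal.exists_le_maximal _ hann
  obtain ⟨r, hr1, hr2⟩ := Submodule.exists_sub_one_mem_and_smul_le_of_fg_of_le_sup
    (I := m) (N := N) (N' := P) (P := P) hP le_rfl (h m hm)
  apply hm.ne_top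
  rw [Ideal.eq_top_iff_one]
  have hrm : r ∈ m := hle (Submodule.mem_colon.2 fun x hx =>
    hr2 (Submodule.smul_mem_pointwise_smul x r _ hx))
  have := m.sub_mem hrm hr1
  simpa using this

section lifting
attribute [local instance] Ideal.Quotient.field

lemma lift_goodPair {S A : Type} [CommRing S] [Nontrivial S] [Finite (MaximalSpectrum S)] [Ring A]
    [Algebra S A] [Module.Finite S A] [Module.Projective S A] (n : ℕ) (hn : 1 ≤ n)
    (hrank : ∀ (k : Type) [Field k] [Algebra S k], Module.finrank k (k ⊗[S] A) = n ^ 2)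
    (hG : ∀ P : MaximalSpectrum S, ∃ (a v : (S ⧸ P.asIdeal) ⊗[S] A) (f : (S ⧸ P.asIdeal)[X]),
      GoodPair (S ⧸ P.asIdeal) n a v f) :
    ∃ (a v : A) (f : S[X]), f.Monic ∧ f.natDegree = n ∧ f.Separable ∧ aeval a f = 0 ∧
      ∃ b : Module.Basis (Fin n × Fin n) S A, ∀ p, b p = a ^ (p.1 : ℕ) * v * a ^ (p.2 : ℕ) := by
  classical
  choose a' v' f' hG using hG
  have hsurj := Ideal.pi_tensorProductMk_quotient_surjective A (fun P : MaximalSpectrum S => P.asIdeal)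
    (fun _ _ ne ↦ Ideal.isCoprime_of_isMaximal (MaximalSpectrum.ext_iff.ne.mp ne))
  obtain ⟨a, ha⟩ := hsurj a'
  obtain ⟨v, hv⟩ := hsurj v'
  have ha' : ∀ P, (1 : S ⧸ P.asIdeal) ⊗ₜ[S] a = a' P := fun P => congrFun ha P
  have hv' : ∀ P, (1 : S ⧸ P.asIdeal) ⊗ₜ[S] v = v' P := fun P => congrFun hv P
  let w : Fin n × Fin n → A := fun p => a ^ (p.1 : ℕ) * v * a ^ (p.2 : ℕ)
  have hw : ∀ (P : MaximalSpectrum S) p, (1 : S ⧸ P.asIdeal) ⊗ₜ[S] w p =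
      a' P ^ (p.1 : ℕ) * v' P * a' P ^ (p.2 : ℕ) := by
    intro P p
    rw [← ha', ← hv']
    simp [w]
  have hne : Nonempty (Fin n × Fin n) := ⟨(⟨0, hn⟩, ⟨0, hn⟩)⟩
  have hspan : Submodule.span S (Set.range w) = ⊤ := by
    apply nak_aux
    intro m hm x
    let P : MaximalSpectrum S := ⟨m, hm⟩
    let bb := basisOfLinearIndependentOfCardEqFinrank (hG P).2.2.2.2
      (by rw [hrank]; simp [sq])
    have h1 := bb.sum_repr (1 ⊗ₜ x)
    choose s hs using fun p => Ideal.Quotient.mk_surjective (bb.repr (1 ⊗ₜ x) p)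
    have h2 : (1 : S ⧸ m) ⊗ₜ[S] (∑ p, s p • w p) = 1 ⊗ₜ x := by
      rw [← h1, TensorProduct.tmul_sum]
      apply Finset.sum_congr rfl
      intro p _
      rw [← hs, TensorProduct.tmul_smul]
      have h3 : bb p = (1 : S ⧸ m) ⊗ₜ[S] w p := by
        rw [hw P]; simp [bb]
      rw [h3]
      exact (algebraMap_smul (S ⧸ m) (s p) ((1 : S ⧸ m) ⊗ₜ[S] w p)).symm
    have h4 : x - ∑ p, s p • w p ∈ m • (⊤ : Submodule S A) := by
      apply mem_smul_top_of_tmul_eq_zero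
      rw [TensorProduct.tmul_sub, h2, sub_self]
    rw [← add_sub_cancel (∑ p, s p • w p) x]
    exact Submodule.add_mem_sup (Submodule.sum_mem _ fun p _ =>
      Submodule.smul_mem _ _ (Submodule.subset_span ⟨p, rfl⟩)) h4
  -- powers
  let M : Submodule S A := Subalgebra.toSubmodule (Algebra.adjoin S {a})
  have hM : ∀ x, x ∈ M ↔ ∃ g : S[X], aeval a g = x := by
    intro x
    simp only [M, Algebra.adjoin_singleton_eq_range_aeval]
    rfl
  have hMfg : M.FG := IsIntegral.fg_adjoin_singleton (Algebra.IsIntegral.isIntegral a)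
  let N : Submodule S A := Submodule.span S (Set.range fun i : Fin n => a ^ (i : ℕ))
  have hMN : M ≤ N := by
    apply nak_aux2 _ _ hMfg
    intro m hm
    let P : MaximalSpectrum S := ⟨m, hm⟩
    have hlift : f' P ∈ lifts (Ideal.Quotient.mk m) :=
      (mem_lifts _).2 (map_surjective _ Ideal.Quotient.mk_surjective _)
    obtain ⟨f₀, hf1, hf2, hf3⟩ := lifts_and_natDegree_eq_and_monic hlift (hG P).1
    have h0 : (1 : S ⧸ m) ⊗ₜ[S] (aeval a f₀) = 0 := by
      have h1 : aeval (a' P) (f' P) = 0 := (hG P).2.2.2.1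
      rw [← hf1] at h1
      have h2 : aeval (a' P) (f₀.map (Ideal.Quotient.mk m)) = aeval (a' P) f₀ :=
        aeval_map_algebraMap (S ⧸ m) (a' P) f₀
      rw [h2, ← ha'] at h1
      have h3 := aeval_algHom_apply
        (Algebra.TensorProduct.includeRight : A →ₐ[S] (S ⧸ m) ⊗[S] A) a f₀
      rw [Algebra.TensorProduct.includeRight_apply, Algebra.TensorProduct.includeRight_apply] at h3
      rw [← h3]
      exact h1
    have h1 : aeval a f₀ * v ∈ m • Submodule.span S (Set.range w) := by
      rw [hspan]
      apply mem_smul_top_of_tmul_eq_zero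
      have : (1 : S ⧸ m) ⊗ₜ[S] (aeval a f₀ * v) = (1 ⊗ₜ (aeval a f₀)) * (1 ⊗ₜ v) := by simp
      rw [this, h0, zero_mul]
    rw [Submodule.mem_ideal_smul_span_iff_exists_sum] at h1
    obtain ⟨c, hcm, hc⟩ := h1
    rw [Finsupp.sum_fintype _ _ (by simp)] at hc
    have hall : ∀ b : A, aeval a f₀ * b = ∑ p, c p • (a ^ (p.1 : ℕ) * b * a ^ (p.2 : ℕ)) := by
      intro b
      have hb : b ∈ Submodule.span S (Set.range w) := by rw [hspan]; trivial
      induction hb using Submodule.span_induction with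
      | mem x hx =>
        obtain ⟨q, rfl⟩ := hx
        have hcomm : aeval a f₀ * a ^ (q.1 : ℕ) = a ^ (q.1 : ℕ) * aeval a f₀ := by
          have : a ^ (q.1 : ℕ) = aeval a (X ^ (q.1 : ℕ) : S[X]) := by simp
          rw [this, ← map_mul, ← map_mul, mul_comm]
        have hpp : ∀ i j : ℕ, a ^ i * a ^ j = a ^ j * a ^ i := fun i j => by
          rw [← pow_add, ← pow_add, add_comm]
        calc aeval a f₀ * (a ^ (q.1 : ℕ) * v * a ^ (q.2 : ℕ))
            = a ^ (q.1 : ℕ) * (aeval a f₀ * v) * a ^ (q.2 : ℕ) := by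
              rw [← mul_assoc, ← mul_assoc, hcomm, mul_assoc (a ^ (q.1 : ℕ))]
          _ = _ := by
              rw [← hc, Finset.mul_sum, Finset.sum_mul]
              apply Finset.sum_congr rfl
              intro p _
              rw [mul_smul_comm, smul_mul_assoc]
              congr 1
              change a ^ (q.1 : ℕ) * (a ^ (p.1 : ℕ) * v * a ^ (p.2 : ℕ)) * a ^ (q.2 : ℕ) =
                a ^ (p.1 : ℕ) * (a ^ (q.1 : ℕ) * v * a ^ (q.2 : ℕ)) * a ^ (p.2 : ℕ)
              rw [mul_assoc _ _ (a ^ (q.2 : ℕ)), mul_assoc _ _ (a ^ (q.2 : ℕ)), hpp p.2 q.2,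
                ← mul_assoc, ← mul_assoc, ← mul_assoc, hpp q.1 p.1]
              simp only [mul_assoc]
      | zero => simp
      | add x y _ _ hx hy => simp only [mul_add, add_mul, smul_add, Finset.sum_add_distrib, hx, hy]
      | smul t x _ hx =>
        rw [mul_smul_comm, hx, Finset.smul_sum]
        apply Finset.sum_congr rfl
        intro p _
        rw [mul_smul_comm, smul_mul_assoc, smul_comm]
    intro x hx
    obtain ⟨g, rfl⟩ := (hM x).1 hx
    rw [← modByMonic_add_div g f₀, map_add, map_mul]
    apply Submodule.add_mem_sup
    · have hlt : (g %ₘ f₀).natDegree < n := by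
        have hd : f₀.natDegree = n := hf2.trans (hG P).2.1
        have := natDegree_modByMonic_lt g hf3 (by
          intro h1; rw [h1, natDegree_one] at hd; omega)
        omega
      rw [aeval_eq_sum_range' hlt, Finset.sum_range]
      exact Submodule.sum_mem _ fun i _ =>
        Submodule.smul_mem _ _ (Submodule.subset_span ⟨i, rfl⟩)
    · rw [hall]
      refine Submodule.sum_mem _ fun p _ => Submodule.smul_mem_smul (hcm p) ?_
      exact (hM _).2 ⟨X ^ (p.1 : ℕ) * (g /ₘ f₀) * X ^ (p.2 : ℕ), by simp⟩
  have han : a ^ n ∈ N := hMN ((hM _).2 ⟨X ^ n, by simp⟩)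
  obtain ⟨c, hc⟩ := (Submodule.mem_span_range_iff_exists_fun S).1 han
  let g : S[X] := ∑ i : Fin n, C (c i) * X ^ (i : ℕ)
  have hgd : g.degree < n := degree_sum_fin_lt c
  let f : S[X] := X ^ n - g
  have hfm : f.Monic := monic_X_pow_sub hgd
  have hfd : f.natDegree = n := by
    apply natDegree_eq_of_degree_eq_some
    rw [degree_sub_eq_left_of_degree_lt, degree_X_pow]
    rwa [degree_X_pow]
  have hfa : aeval a f = 0 := by
    simp only [f, g, map_sub, map_sum, map_mul, map_pow, aeval_X, aeval_C]
    rw [sub_eq_zero, ← hc]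
    simp [Algebra.smul_def]
  have hfP : ∀ P : MaximalSpectrum S, f.map (Ideal.Quotient.mk P.asIdeal) = f' P := by
    intro P
    apply goodPair_unique hn (hG P) (hfm.map _)
    · rw [hfm.natDegree_map, hfd]
    · have h2 : aeval (a' P) (f.map (Ideal.Quotient.mk P.asIdeal)) = aeval (a' P) f :=
        aeval_map_algebraMap (S ⧸ P.asIdeal) (a' P) f
      rw [h2, ← ha']
      have h3 := aeval_algHom_apply
        (Algebra.TensorProduct.includeRight : A →ₐ[S] (S ⧸ P.asIdeal) ⊗[S] A) a f
      rw [Algebra.TensorProduct.includeRight_apply] at h3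
      rw [h3, hfa, map_zero]
  have hfs : f.Separable := by
    rw [separable_iff_resultant hfm hfd]
    by_contra hu
    obtain ⟨m, hm, hmem⟩ := exists_max_ideal_of_mem_nonunits hu
    let P : MaximalSpectrum S := ⟨m, hm⟩
    have h1 := (hG P).2.2.1
    rw [separable_iff_resultant (hG P).1 (hG P).2.1, ← hfP P, derivative_map, resultant_map_map] at h1
    apply h1.ne_zero
    exact Ideal.Quotient.eq_zero_iff_mem.2 hmem
  refine ⟨a, v, f, hfm, hfd, hfs, hfa, ?_⟩
  have hbij : Function.Bijective (Fintype.linearCombination S w) := by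
    apply Module.bijective_of_surjective_of_rankAtStalk_eq
    · rw [← LinearMap.range_eq_top, Fintype.range_linearCombination, hspan]
    · intro m hm
      rw [Module.rankAtStalk_eq_finrank_of_free]
      have h1 := finrank_eq_rankAtStalk (T := S) A (S ⧸ m)
      rw [hrank] at h1
      have h2 : PrimeSpectrum.comap (algebraMap S (S ⧸ m)) ⊥ = ⟨m, hm.isPrime⟩ := by
        ext x
        simp only [PrimeSpectrum.comap_asIdeal, Ideal.mem_comap]
        change _ ∈ (⊥ : Ideal _) ↔ _
        rw [Ideal.mem_bot]
        exact Ideal.Quotient.eq_zero_iff_mem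
      rw [h2] at h1
      rw [← h1]
      simp [sq]
  refine ⟨(Module.Basis.ofEquivFun (LinearEquiv.ofBijective _ hbij).symm), fun p => ?_⟩
  rw [Module.Basis.coe_ofEquivFun]
  simp [w]

end lifting

open TensorProduct Polynomial

lemma exists_matrix_hom {S A : Type} [CommRing S] [Ring A] [Algebra S A] (n : ℕ) (a v : A)
    (f : S[X]) (hf : f.Monic) (hfd : f.natDegree = n) (hfa : aeval a f = 0)
    (b : Module.Basis (Fin n × Fin n) S A)
    (hb : ∀ p, b p = a ^ (p.1 : ℕ) * v * a ^ (p.2 : ℕ)) :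
    Nonempty (A →ₐ[S] Matrix (Fin n) (Fin n) (AdjoinRoot f)) := by
  classical
  let x : AdjoinRoot f := AdjoinRoot.root f
  have hb0 : ∃ b : Module.Basis (Fin n) S (AdjoinRoot f), ∀ i, b i = x ^ (i : ℕ) := by
    subst hfd
    refine ⟨(AdjoinRoot.powerBasis' hf).basis.reindex
      (finCongr (AdjoinRoot.powerBasis'_dim hf)), fun i => ?_⟩
    rw [Module.Basis.reindex_apply, PowerBasis.basis_eq_pow, AdjoinRoot.powerBasis'_gen]
    rfl
  obtain ⟨pb, hpb⟩ := hb0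
  have hev : ∃ ev : AdjoinRoot f →ₐ[S] A, ev x = a := by
    refine ⟨Ideal.Quotient.liftₐ (Ideal.span {f}) (aeval a) ?_, ?_⟩
    · intro g hg
      obtain ⟨q, rfl⟩ := Ideal.mem_span_singleton'.1 hg
      rw [map_mul, hfa, mul_zero]
    · exact (Ideal.Quotient.liftₐ_apply _ _ _ _).trans (by
        change aeval a (X : S[X]) = a
        simp)
  obtain ⟨ev, hev⟩ := hev
  have hcomm : ∀ p q, Commute (ev p) (ev q) := fun p q => by
    rw [Commute, SemiconjBy, ← map_mul, ← map_mul, mul_comm]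
  let inst : Module (AdjoinRoot f) A :=
    Module.compHom A ((ev : AdjoinRoot f →+* A).toOpposite hcomm)
  have hsmul : ∀ (e : AdjoinRoot f) (y : A), e • y = y * ev e := fun e y => rfl
  let u : Fin n → A := fun i => a ^ (i : ℕ) * v
  have hexp : ∀ (e : AdjoinRoot f) (i : Fin n), e • u i = ∑ j, pb.repr e j • b (i, j) := by
    intro e i
    conv_lhs => rw [← pb.sum_repr e]
    rw [hsmul, map_sum, Finset.mul_sum]
    apply Finset.sum_congr rfl
    intro j _
    rw [map_smul, hpb, map_pow, hev, mul_smul_comm, hb]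
  have hLI : LinearIndependent (AdjoinRoot f) u := by
    rw [Fintype.linearIndependent_iff]
    intro g hg i
    simp only [hexp] at hg
    rw [← Fintype.sum_prod_type' (f := fun i j => pb.repr (g i) j • b (i, j))] at hg
    have h1 := Fintype.linearIndependent_iff.1 b.linearIndependent
      (fun p => pb.repr (g p.1) p.2) hg
    apply pb.repr.injective
    ext j
    simpa using h1 (i, j)
  have hspan : ⊤ ≤ Submodule.span (AdjoinRoot f) (Set.range u) := by
    rintro y -
    rw [← b.sum_repr y]
    refine Submodule.sum_mem _ fun p _ => ?_
    have : b.repr y p • b p = (b.repr y p • x ^ (p.2 : ℕ)) • u p.1 := by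
      rw [hsmul, map_smul, map_pow, hev, mul_smul_comm, hb]
    rw [this]
    exact Submodule.smul_mem _ _ (Submodule.subset_span ⟨_, rfl⟩)
  let B : Module.Basis (Fin n) (AdjoinRoot f) A := Module.Basis.mk hLI hspan
  let lm : A →+* Module.End (AdjoinRoot f) A :=
    { toFun := fun y =>
        { toFun := fun z => y * z
          map_add' := fun z z' => mul_add _ _ _
          map_smul' := fun e z => by
            rw [hsmul, RingHom.id_apply, hsmul, mul_assoc] }
      map_one' := by ext z; exact one_mul z
      map_mul' := fun y y' => by ext z; exact mul_assoc y y' z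
      map_zero' := by ext z; exact zero_mul z
      map_add' := fun y y' => by ext z; exact add_mul y y' z }
  let Φ : A →+* Matrix (Fin n) (Fin n) (AdjoinRoot f) :=
    (LinearMap.toMatrixAlgEquiv B : _ →+* _).comp lm
  refine ⟨{ Φ with commutes' := fun s => ?_ }⟩
  change LinearMap.toMatrixAlgEquiv B (lm (algebraMap S A s)) = _
  have h1 : lm (algebraMap S A s) = algebraMap (AdjoinRoot f) _ (algebraMap S _ s) := by
    ext z
    rw [Module.algebraMap_end_apply, hsmul, AlgHom.commutes]
    exact Algebra.commutes s z
  rw [h1, AlgEquiv.commutes]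
  exact (IsScalarTower.algebraMap_apply S (AdjoinRoot f) _ s).symm

section splitting
attribute [local instance] Ideal.Quotient.field

lemma split_bijective {S C A : Type} [CommRing S] [CommRing C] [Ring A] [Algebra S A] [Algebra S C]
    (n : ℕ) (hn : 1 ≤ n) (b : Module.Basis (Fin n × Fin n) S A)
    (hsimple : ∀ (k : Type) [Field k] [Algebra S k], IsSimpleRing (k ⊗[S] A))
    (Φ : A →ₐ[S] Matrix (Fin n) (Fin n) C) :
    ∃ L : C ⊗[S] A ≃ₐ[C] Matrix (Fin n) (Fin n) C, ∀ x, L (1 ⊗ₜ x) = Φ x := by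
  classical
  let L : C ⊗[S] A →ₐ[C] Matrix (Fin n) (Fin n) C :=
    Algebra.TensorProduct.lift (Algebra.ofId C _) Φ (fun c x => Algebra.commutes c (Φ x))
  have hL : ∀ c x, L (c ⊗ₜ x) = c • Φ x := fun c x => by
    rw [Algebra.smul_def]
    exact Algebra.TensorProduct.lift_tmul _ _ _ _ _
  have hnt : Nonempty (Fin n) := ⟨⟨0, hn⟩⟩
  have hsurj : Function.Surjective L := by
    have : LinearMap.range L.toLinearMap = ⊤ := by
      apply nak_aux
      intro m hm x
      let q : C →ₐ[S] (C ⧸ m) := Ideal.Quotient.mkₐ S m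
      let Φκ : A →ₐ[S] Matrix (Fin n) (Fin n) (C ⧸ m) := q.mapMatrix.comp Φ
      let Lκ : (C ⧸ m) ⊗[S] A →ₐ[C ⧸ m] Matrix (Fin n) (Fin n) (C ⧸ m) :=
        Algebra.TensorProduct.lift (Algebra.ofId _ _) Φκ (fun c x => Algebra.commutes c (Φκ x))
      have hLκ : ∀ c x, Lκ (c ⊗ₜ x) = c • Φκ x := fun c x => by
        rw [Algebra.smul_def]
        exact Algebra.TensorProduct.lift_tmul _ _ _ _ _
      have hsim := hsimple (C ⧸ m)
      have hinj : Function.Injective Lκ := RingHom.injective Lκ.toRingHom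
      have hfd : Module.Finite (C ⧸ m) ((C ⧸ m) ⊗[S] A) := Module.Finite.of_basis (b.baseChange _)
      have hsurj : Function.Surjective Lκ := by
        have := (LinearMap.injective_iff_surjective_of_finrank_eq_finrank
          (f := Lκ.toLinearMap) (by
            rw [Module.finrank_eq_card_basis (b.baseChange (C ⧸ m)), Module.finrank_matrix]
            simp)).1 hinj
        exact this
      have hcomp : ∀ z, ∃ y, Lκ z = q.mapMatrix (L y) := by
        intro z
        induction z with
        | zero => exact ⟨0, by simp⟩
        | add z z' hz hz' =>
          obtain ⟨y, hy⟩ := hz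
          obtain ⟨y', hy'⟩ := hz'
          exact ⟨y + y', by rw [map_add, map_add, map_add, hy, hy']⟩
        | tmul c y =>
          obtain ⟨c, rfl⟩ := Ideal.Quotient.mk_surjective c
          refine ⟨c ⊗ₜ y, ?_⟩
          rw [hLκ, hL]
          ext i j
          simp [Φκ, q]
      obtain ⟨z, hz⟩ := hsurj (q.mapMatrix x)
      obtain ⟨y, hy⟩ := hcomp z
      rw [hz] at hy
      rw [← add_sub_cancel (L y) x]
      refine Submodule.add_mem_sup ⟨y, rfl⟩ ?_
      rw [Matrix.matrix_eq_sum_single (x - L y)]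
      refine Submodule.sum_mem _ fun i _ => Submodule.sum_mem _ fun j _ => ?_
      have hmem : (x - L y) i j ∈ m := by
        rw [← Ideal.Quotient.eq_zero_iff_mem, Matrix.sub_apply, map_sub, sub_eq_zero]
        exact congrFun (congrFun hy i) j
      have h1 : Matrix.single i j ((x - L y) i j) =
          ((x - L y) i j) • Matrix.single i j (1 : C) := by
        rw [Matrix.smul_single, smul_eq_mul, mul_one]
      rw [h1]
      exact Submodule.smul_mem_smul hmem trivial
    exact LinearMap.range_eq_top.1 this
  have hinj : Function.Injective L := by
    let e : Matrix (Fin n) (Fin n) C ≃ₗ[C] C ⊗[S] A :=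
      (Matrix.stdBasis C (Fin n) (Fin n)).equiv (b.baseChange C) (Equiv.refl _)
    have : Module.Finite C (C ⊗[S] A) := Module.Finite.of_basis (b.baseChange _)
    have h1 := OrzechProperty.injective_of_surjective_endomorphism
      (e.toLinearMap ∘ₗ L.toLinearMap) (e.surjective.comp hsurj)
    have h2 : Function.Injective (e ∘ L) := h1
    exact Function.Injective.of_comp h2
  exact ⟨AlgEquiv.ofBijective L ⟨hinj, hsurj⟩, fun x =>
    (hL 1 x).trans (one_smul _ _)⟩

end splitting

open TensorProduct Polynomial

lemma exists_roots_list {T₀ : Type} [CommRing T₀] (l : List T₀[X])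
    (hl : ∀ g ∈ l, g.Monic ∧ g.Separable ∧ (Nontrivial T₀ → 1 ≤ g.natDegree)) :
    ∃ (T : Type) (_ : CommRing T) (_ : Algebra T₀ T), Module.FaithfullyFlat T₀ T ∧
      Module.Finite T₀ T ∧ Algebra.Etale T₀ T ∧ ∀ g ∈ l, ∃ x : T, aeval x g = 0 := by
  induction l with
  | nil =>
    exact ⟨T₀, inferInstance, inferInstance, inferInstance, inferInstance, inferInstance,
      fun g hg => by simp at hg⟩
  | cons g l ih =>
    obtain ⟨T, _, _, h1, h2, h3, h4⟩ := ih fun g hg => hl g (List.mem_cons_of_mem _ hg)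
    obtain ⟨hm, hs, hd⟩ := hl g List.mem_cons_self
    let g' : T[X] := g.map (algebraMap T₀ T)
    have hm' : g'.Monic := hm.map _
    have hs' : g'.Separable := hs.map
    have he : Algebra.Etale T (AdjoinRoot g') := etale_adjoinRoot g' hm' hs'
    have hfin : Module.Finite T (AdjoinRoot g') := hm'.finite_adjoinRoot
    have hfree : Module.Free T (AdjoinRoot g') := hm'.free_adjoinRoot
    have hff : Module.FaithfullyFlat T (AdjoinRoot g') := by
      rcases subsingleton_or_nontrivial T with hT | hT
      · refine ⟨fun {m} hm => ?_⟩
        exact absurd (Subsingleton.elim _ _) hm.ne_top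
      · have hd' : g'.natDegree ≠ 0 := by
          have := hd (algebraMap T₀ T).domain_nontrivial
          rw [hm.natDegree_map]
          omega
        have : Nontrivial (AdjoinRoot g') := by
          refine Ideal.Quotient.nontrivial_iff.2 fun h => ?_
          rw [Ideal.span_singleton_eq_top] at h
          rw [hm'.isUnit_iff] at h
          rw [h] at hd'
          exact hd' Polynomial.natDegree_one
        infer_instance
    refine ⟨AdjoinRoot g', inferInstance, inferInstance, Module.FaithfullyFlat.trans T₀ T _,
      Module.Finite.trans T _, Algebra.Etale.comp T₀ T _, ?_⟩
    intro p hp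
    rcases List.mem_cons.1 hp with rfl | hp
    · refine ⟨AdjoinRoot.root g', ?_⟩
      have := AdjoinRoot.eval₂_root g'
      rw [Polynomial.eval₂_map] at this
      exact this
    · obtain ⟨x, hx⟩ := h4 p hp
      refine ⟨algebraMap T _ x, ?_⟩
      rw [Polynomial.aeval_algebraMap_apply, hx, map_zero]


lemma exists_root_tensor {R S : Type} [CommRing R] [CommRing S] [Algebra R S] [Algebra.Etale R S]
    [Module.Finite R S] {ℓ : ℕ} (hℓ : Module.rankAtStalk (R := R) S = ℓ) (f : S[X]) (hf : f.Monic)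
    (hs : f.Separable) (hd : 1 ≤ f.natDegree) :
    ∃ (T : Type) (_ : CommRing T) (_ : Algebra R T), Module.FaithfullyFlat R T ∧
      Module.Finite R T ∧ Algebra.Etale R T ∧
      ∃ y : S ⊗[R] T, aeval y f = 0 := by
  classical
  obtain ⟨T₀, _, _, h1, h2, h3, h4⟩ := Algebra.IsFiniteSplit.exists_tensorProduct_of_etale hℓ
  obtain ⟨r, ⟨e⟩⟩ := h4.nonempty_algEquiv_fun
  let χ : Fin r → S →+* T₀ := fun i =>
    (Pi.evalRingHom (fun _ => T₀) i).comp (e.toAlgHom.toRingHom.comp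
      (Algebra.TensorProduct.includeRight : S →ₐ[R] T₀ ⊗[R] S).toRingHom)
  obtain ⟨T, _, _, g1, g2, g3, g4⟩ := exists_roots_list (List.ofFn fun i => f.map (χ i)) (by
    intro g hg
    obtain ⟨i, rfl⟩ := (List.mem_ofFn' _ _).1 hg
    exact ⟨hf.map _, hs.map, fun _ => by rw [hf.natDegree_map]; exact hd⟩)
  have g5 : ∀ i, ∃ x : T, aeval x (f.map (χ i)) = 0 := fun i =>
    g4 _ ((List.mem_ofFn' _ _).2 ⟨i, rfl⟩)
  choose x hx using g5
  let _ : Algebra R T := ((algebraMap T₀ T).comp (algebraMap R T₀)).toAlgebra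
  have : IsScalarTower R T₀ T := IsScalarTower.of_algebraMap_eq fun _ => rfl
  refine ⟨T, inferInstance, inferInstance, Module.FaithfullyFlat.trans R T₀ T,
    Module.Finite.trans T₀ T, Algebra.Etale.comp R T₀ T, ?_⟩
  let E1 : T ⊗[T₀] (Fin r → T₀) ≃ₐ[T] (Fin r → T) :=
    (Algebra.TensorProduct.piRight T₀ T T (fun _ : Fin r => T₀)).trans
      (AlgEquiv.piCongrRight fun i => Algebra.TensorProduct.rid T₀ T T)
  have hE1 : ∀ z, E1 (1 ⊗ₜ z) = fun i => algebraMap T₀ T (z i) := by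
    intro z
    ext i
    simp [E1, Algebra.smul_def]
  let E2 : T ⊗[T₀] (T₀ ⊗[R] S) ≃ₐ[T] T ⊗[T₀] (Fin r → T₀) :=
    Algebra.TensorProduct.congr AlgEquiv.refl e
  let E3 : T ⊗[T₀] (T₀ ⊗[R] S) ≃ₐ[T] T ⊗[R] S :=
    Algebra.TensorProduct.cancelBaseChange R T₀ T T S
  let θ : (Fin r → T) →+* S ⊗[R] T :=
    ((Algebra.TensorProduct.comm R T S).toAlgHom.toRingHom.comp E3.toAlgHom.toRingHom).comp
      (E2.symm.toAlgHom.toRingHom.comp E1.symm.toAlgHom.toRingHom)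
  have hθ : ∀ s, θ (fun i => algebraMap T₀ T (χ i s)) = algebraMap S _ s := by
    intro s
    have h : (fun i => algebraMap T₀ T (χ i s)) = E1 (E2 (1 ⊗ₜ (1 ⊗ₜ s))) := by
      have : E2 (1 ⊗ₜ (1 ⊗ₜ s)) = 1 ⊗ₜ (e (1 ⊗ₜ s)) := by
        simp [E2]
      rw [this, hE1]
      rfl
    rw [h]
    change Algebra.TensorProduct.comm R T S (E3 (E2.symm (E1.symm _))) = _
    rw [AlgEquiv.symm_apply_apply, AlgEquiv.symm_apply_apply]
    simp [E3]
  refine ⟨θ x, ?_⟩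
  have hx' : eval₂ (RingHom.pi fun i => (algebraMap T₀ T).comp (χ i)) x f = 0 := by
    ext i
    have := hx i
    rw [aeval_def, eval₂_map] at this
    rw [Pi.zero_apply, ← this]
    exact Polynomial.hom_eval₂ f _ (Pi.evalRingHom _ i) x
  have h5 : (algebraMap S (S ⊗[R] T)) =
      θ.comp (RingHom.pi fun i => (algebraMap T₀ T).comp (χ i)) := by
    ext s
    exact (hθ s).symm
  rw [aeval_def, h5, ← Polynomial.hom_eval₂, hx', map_zero]

open TensorProduct Polynomial

section final
attribute [local instance] Ideal.Quotient.field

lemma main_abs {R S A : Type} [CommRing R] [CommRing S] [Ring A] [Nontrivial A]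
    [Algebra R S] [Algebra R A] [Algebra S A] [IsScalarTower R S A]
    (hsemi : IsSemilocalRing R)
    (hinj : Function.Injective (algebraMap S A))
    (hc : ∀ z : A, (∀ b, b * z = z * b) → z ∈ (algebraMap S A).range)
    (hsep : IsSeparableAlgebra R A) [Module.Finite R A] [Module.Projective R A] (ℓ n : ℕ)
    (hrankS : ∀ (p : Ideal R), p.IsPrime → rankAt R S p = ℓ)
    (hdegA : ∀ (q : Ideal S), q.IsPrime → rankAt S A q = n ^ 2) :
    ∃ (T : Type) (_ : CommRing T) (_ : Algebra R T), Module.FaithfullyFlat R T ∧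
      Module.Finite R T ∧ Algebra.Etale R T ∧
      Nonempty ((S ⊗[R] T) ⊗[S] A ≃ₐ[S ⊗[R] T] Matrix (Fin n) (Fin n) (S ⊗[R] T)) := by
  obtain ⟨i1, i2, i3, i4, i5⟩ := center_facts hinj hc hsep
  have hsepS : IsSeparableAlgebra S A := sep_restrict S hsep
  have : Nontrivial S := by
    by_contra h
    rw [not_nontrivial_iff_subsingleton] at h
    have : (1 : A) = 0 := by
      rw [← map_one (algebraMap S A), Subsingleton.elim (1 : S) 0, map_zero]
    exact one_ne_zero this
  have hfinM : Finite (MaximalSpectrum S) := finite_maxSpec hsemi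
  have hrank : ∀ (k : Type) [Field k] [Algebra S k], Module.finrank k (k ⊗[S] A) = n ^ 2 := by
    intro k _ _
    rw [finrank_eq_rankAtStalk, ← rankAt_eq_rankAtStalk]
    exact hdegA _ (PrimeSpectrum.isPrime _)
  have hsimple : ∀ (k : Type) [Field k] [Algebra S k], IsSimpleRing (k ⊗[S] A) :=
    fun k _ _ => simple_fiber hinj hc hsepS
  have hn : 1 ≤ n := by
    by_contra h
    obtain rfl : n = 0 := by omega
    obtain ⟨m, hm⟩ := Ideal.exists_maximal S
    have h1 := hrank (S ⧸ m)
    have := hsimple (S ⧸ m)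
    have h2 := Module.finrank_pos (R := S ⧸ m) (M := (S ⧸ m) ⊗[S] A)
    rw [h1] at h2
    simp at h2
  have hG : ∀ P : MaximalSpectrum S, ∃ (a v : (S ⧸ P.asIdeal) ⊗[S] A) (f : (S ⧸ P.asIdeal)[X]),
      GoodPair (S ⧸ P.asIdeal) n a v f := by
    intro P
    have := hsimple (S ⧸ P.asIdeal)
    have hc' : ∀ z : (S ⧸ P.asIdeal) ⊗[S] A, (∀ b, b * z = z * b) →
        ∃ c : S ⧸ P.asIdeal, z = algebraMap _ _ c := central_fiber hc hsepS
    refine exists_goodPair hc' ?_ n hn (hrank _)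
    refine simple_fiber (RingHom.injective _) ?_ (sep_baseChange _ hsepS)
    intro z hz
    obtain ⟨c, hc⟩ := hc' z hz
    exact ⟨c, hc.symm⟩
  obtain ⟨a, v, f, hf, hfd, hfs, hfa, b, hb⟩ := lift_goodPair n hn hrank hG
  obtain ⟨Φ⟩ := exists_matrix_hom n a v f hf hfd hfa b hb
  have hℓ : Module.rankAtStalk (R := R) S = ℓ := by
    ext p
    rw [← rankAt_eq_rankAtStalk]
    exact hrankS _ p.2
  obtain ⟨T, _, _, h1, h2, h3, y, hy⟩ := exists_root_tensor hℓ f hf hfs (by omega)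
  refine ⟨T, inferInstance, inferInstance, h1, h2, h3, ?_⟩
  have hh : Nonempty (AdjoinRoot f →ₐ[S] S ⊗[R] T) :=
    ⟨AdjoinRoot.liftAlgHom f (Algebra.ofId _ _) y hy⟩
  obtain ⟨h⟩ := hh
  obtain ⟨L, hL⟩ := split_bijective n hn b hsimple (h.mapMatrix.comp Φ)
  exact ⟨L⟩

lemma transfer {R S A T : Type} [CommRing R] [CommRing S] [Ring A] [CommRing T] [Algebra R T]
    [Algebra R S] [Algebra R A] [Algebra S A] [IsScalarTower R S A] (n : ℕ)
    (L : (S ⊗[R] T) ⊗[S] A ≃ₐ[S ⊗[R] T] Matrix (Fin n) (Fin n) (S ⊗[R] T)) :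
    ∃ ψ : (T ⊗[R] A) ≃ₐ[R] Matrix (Fin n) (Fin n) (T ⊗[R] S),
        ∀ (s : T ⊗[R] S) (x : T ⊗[R] A),
          ψ ((Algebra.TensorProduct.map (AlgHom.id R T) (IsScalarTower.toAlgHom R S A) s) * x)
            = algebraMap (T ⊗[R] S) (Matrix (Fin n) (Fin n) (T ⊗[R] S)) s * ψ x := by
  let C := S ⊗[R] T
  let σ : S ⊗[R] T ≃ₐ[R] T ⊗[R] S := Algebra.TensorProduct.comm R S T
  let j : T ⊗[R] A →ₐ[R] (S ⊗[R] T) ⊗[S] A :=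
    Algebra.TensorProduct.lift
      ((Algebra.TensorProduct.includeLeft : (S ⊗[R] T) →ₐ[R] (S ⊗[R] T) ⊗[S] A).comp
        Algebra.TensorProduct.includeRight)
      ((Algebra.TensorProduct.includeRight : A →ₐ[S] (S ⊗[R] T) ⊗[S] A).restrictScalars R)
      (fun t x => by
        simp [Commute, SemiconjBy])
  have hj : ∀ t x, j (t ⊗ₜ x) = (1 ⊗ₜ t) ⊗ₜ x := by
    intro t x
    refine (Algebra.TensorProduct.lift_tmul _ _ _ _ _).trans ?_
    change ((1 ⊗ₜ t) ⊗ₜ[S] (1 : A)) * (1 ⊗ₜ[S] x) = _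
    rw [Algebra.TensorProduct.tmul_mul_tmul, mul_one, one_mul]
  have hjb : Function.Bijective j := by
    let e1 : T ⊗[R] A ≃+ A ⊗[R] T := (TensorProduct.comm R T A).toAddEquiv
    let e2 : A ⊗[R] T ≃+ A ⊗[S] (S ⊗[R] T) :=
      (TensorProduct.AlgebraTensorModule.cancelBaseChange R S S A T).symm.toAddEquiv
    let e3 : A ⊗[S] (S ⊗[R] T) ≃+ (S ⊗[R] T) ⊗[S] A := (TensorProduct.comm S A _).toAddEquiv
    have : ∀ z, j z = (e1.trans (e2.trans e3)) z := by
      intro z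
      induction z with
      | zero => rw [map_zero, map_zero]
      | add z z' hz hz' => rw [map_add, map_add, hz, hz']
      | tmul t x =>
        rw [hj]
        simp [e1, e2, e3]
    have h2 : (j : _ → _) = e1.trans (e2.trans e3) := funext this
    rw [h2]
    exact (e1.trans (e2.trans e3)).bijective
  let J := AlgEquiv.ofBijective j hjb
  let ψ : (T ⊗[R] A) ≃ₐ[R] Matrix (Fin n) (Fin n) (T ⊗[R] S) :=
    (J.trans (L.restrictScalars R)).trans σ.mapMatrix
  refine ⟨ψ, fun s x => ?_⟩
  rw [map_mul]
  congr 1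
  have key : ∀ s : T ⊗[R] S,
      j (Algebra.TensorProduct.map (AlgHom.id R T) (IsScalarTower.toAlgHom R S A) s)
      = algebraMap (S ⊗[R] T) _ (σ.symm s) := by
    intro z
    induction z with
    | zero => simp
    | add z z' hz hz' => rw [map_add, map_add, hz, hz', map_add, map_add]
    | tmul t s =>
      rw [Algebra.TensorProduct.map_tmul, hj]
      change (1 ⊗ₜ t) ⊗ₜ (algebraMap S A s) = (s ⊗ₜ[R] t) ⊗ₜ[S] (1 : A)
      rw [Algebra.algebraMap_eq_smul_one, ← TensorProduct.smul_tmul, TensorProduct.smul_tmul',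
        smul_eq_mul, mul_one]
  change σ.mapMatrix (L (j _)) = _
  rw [key, AlgEquiv.commutes]
  ext i k
  simp only [AlgEquiv.mapMatrix_apply, Matrix.map_apply, Matrix.algebraMap_matrix_apply]
  split_ifs <;> simp

end final

open TensorProduct Polynomial

lemma rankAt_pos (R T : Type) [CommRing R] [CommRing T] [Algebra R T] [Module.FaithfullyFlat R T]
    [Module.Finite R T] (p : Ideal R) (hp : p.IsPrime) : 0 < rankAt R T p := by
  have : Nontrivial (residueFieldAt R p ⊗[R] T) :=
    Module.FaithfullyFlat.rTensor_nontrivial R T _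
  exact Module.finrank_pos

/-- **Splitting separable projective algebras by finite étale covers.**
Let `R` be a semilocal commutative ring and `A` a separable projective `R`-algebra (hence
Azumaya over its center `S`, which is finite étale over `R`) such that `ℓ = rank_R S` and
`n = deg A` (i.e. `rank_S A = n²`) are constant.  Then there exists a faithfully flat
(positive rank at every prime) finite étale `R`-algebra `T` such that
`T ⊗[R] A ≅ M_n(T ⊗[R] S)` as `T ⊗[R] S`-algebras; the `S_T`-algebra structure of the
isomorphism is recorded by compatibility with the canonical map `S_T → T ⊗[R] A` and with
scalar matrices. -/
theorem separable_projective_split_by_finite_etale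
    (R : Type) [CommRing R] (hsemi : IsSemilocalRing R)
    (A : Type) [Ring A] [Algebra R A]
    (hsep : IsSeparableAlgebra R A)
    (hfin : Module.Finite R A) (hproj : Module.Projective R A)
    (ℓ n : ℕ)
    (hrankS : ∀ (p : Ideal R), p.IsPrime → rankAt R (Subalgebra.center R A) p = ℓ)
    (hdegA : ∀ (q : Ideal (Subalgebra.center R A)), q.IsPrime →
      rankAt (Subalgebra.center R A) A q = n ^ 2) :
    ∃ (T : Type) (_ : CommRing T) (_ : Algebra R T),
      IsFiniteEtale R T ∧
      (∀ (p : Ideal R), p.IsPrime → 0 < rankAt R T p) ∧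
      ∃ ψ : (T ⊗[R] A) ≃ₐ[R]
              Matrix (Fin n) (Fin n) (T ⊗[R] (Subalgebra.center R A)),
        ∀ (s : T ⊗[R] (Subalgebra.center R A)) (x : T ⊗[R] A),
          ψ ((Algebra.TensorProduct.map (AlgHom.id R T)
                (Subalgebra.center R A).val s) * x)
            = algebraMap (T ⊗[R] (Subalgebra.center R A))
                (Matrix (Fin n) (Fin n) (T ⊗[R] (Subalgebra.center R A))) s * ψ x := by
  rcases subsingleton_or_nontrivial A with hA | hA
  · have hS : Subsingleton (Subalgebra.center R A) := inferInstance
    have h1 : Subsingleton (R ⊗[R] A) := inferInstance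
    have h2 : Subsingleton (R ⊗[R] (Subalgebra.center R A)) := inferInstance
    have h3 : Subsingleton
        (Matrix (Fin n) (Fin n) (R ⊗[R] (Subalgebra.center R A))) :=
      inferInstanceAs (Subsingleton (Fin n → Fin n → (R ⊗[R] (Subalgebra.center R A))))
    refine ⟨R, inferInstance, inferInstance, isFiniteEtale_of_etale R R, fun p hp =>
      rankAt_pos R R p hp, ?_⟩
    exact ⟨default, fun s x => Subsingleton.elim _ _⟩
  · let _ : Algebra (Subalgebra.center R A) A :=
      { algebraMap := (Subalgebra.center R A).val.toRingHom
        commutes' := fun r x => ((Subalgebra.mem_center_iff.1 r.2) x).symm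
        smul_def' := fun r x => rfl }
    have : IsScalarTower R (Subalgebra.center R A) A := inferInstance
    obtain ⟨T, _, _, h1, h2, h3, ⟨L⟩⟩ := main_abs (R := R) (S := Subalgebra.center R A) (A := A)
      hsemi Subtype.val_injective
      (fun z hz => ⟨⟨z, Subalgebra.mem_center_iff.2 hz⟩, rfl⟩) hsep ℓ n hrankS hdegA
    have : Module.Projective R T := by
      have : Module.FinitePresentation R T :=
        Module.FinitePresentation.of_finite_of_finitePresentation R T
      exact Module.Flat.projective_of_finitePresentation
    refine ⟨T, inferInstance, inferInstance, isFiniteEtale_of_etale R T,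
      fun p hp => rankAt_pos R T p hp, ?_⟩
    obtain ⟨ψ, hψ⟩ := transfer n L
    exact ⟨ψ, hψ⟩


end
end

section
/- Let R be a connected semilocal commutative ring and S a connected finite étale R-algebra of rank 2^n with n ≥ 1. Then there exists a connected finite étale R-algebra T of odd rank such that S⊗_R T is connected and contains a quadratic étale T-subalgebra, i.e., a T-subalgebra of S⊗_R T that is finite étale of rank 2 over T. -/
open TensorProduct

noncomputable section

/-- A nonzero commutative ring is connected if its only idempotents are `0` and `1`. -/
def IsConnectedRing (R : Type*) [CommRing R] : Prop :=
  (0 : R) ≠ 1 ∧ ∀ e : R, IsIdempotentElem e → e = 0 ∨ e = 1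

/-- **Quadratic étale subalgebras after odd base change.**
Let `R` be a connected semilocal commutative ring and `S` a connected finite étale
`R`-algebra of rank `2^n`, `n ≥ 1`.  Then there is a connected finite étale `R`-algebra `T`
of odd rank such that `S ⊗[R] T` is connected and contains a quadratic étale `T`-subalgebra,
i.e. a `T`-subalgebra which is finite étale of rank `2` over `T`. -/
theorem rankAt_eq {R M : Type*} [CommRing R] [AddCommGroup M] [Module R M] [Module.Finite R M]
    [Module.Flat R M] (p : Ideal R) (hp : p.IsPrime) :
    rankAt R M p = Module.rankAtStalk (R := R) M ⟨p, hp⟩ := by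
  unfold rankAt
  have h := Module.rankAtStalk_baseChange (R := R) (M := M) (S := residueFieldAt R p) ⊥
  have h2 := Module.rankAtStalk_eq_finrank_of_free (R := residueFieldAt R p)
    (M := residueFieldAt R p ⊗[R] M)
  rw [h2] at h
  have h3 : PrimeSpectrum.comap (algebraMap R (residueFieldAt R p)) ⊥ = ⟨p, hp⟩ := by
    ext x
    simp only [PrimeSpectrum.comap_asIdeal, Ideal.mem_comap]
    rw [IsScalarTower.algebraMap_apply R (R ⧸ p) (FractionRing (R ⧸ p))]
    change (algebraMap (R ⧸ p) (FractionRing (R ⧸ p))) (algebraMap R (R ⧸ p) x) ∈ (⊥ : Ideal _) ↔ _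
    rw [Ideal.mem_bot, FaithfulSMul.algebraMap_eq_zero_iff]
    exact Ideal.Quotient.eq_zero_iff_mem
  rw [h3] at h
  simpa using h

theorem modFP_of_etale (R S : Type*) [CommRing R] [CommRing S] [Algebra R S] [Module.Finite R S]
    [Algebra.Etale R S] : Module.FinitePresentation R S :=
  Module.FinitePresentation.of_finite_of_finitePresentation R S

theorem proj_of_etale (R S : Type*) [CommRing R] [CommRing S] [Algebra R S] [Module.Finite R S]
    [Algebra.Etale R S] : Module.Projective R S := by
  have := modFP_of_etale R S
  exact Module.Flat.projective_of_finitePresentation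

theorem isSep_iff {R S : Type*} [CommRing R] [CommRing S] [Algebra R S] :
    IsSeparableAlgebra R S ↔ ∃ t : S ⊗[R] S,
      (∀ s, ((1 : S) ⊗ₜ[R] s - s ⊗ₜ[R] (1 : S)) * t = 0) ∧
        Algebra.TensorProduct.lmul' R t = 1 := by
  unfold IsSeparableAlgebra
  have h1 (t : S ⊗[R] S) (s : S) :
      LinearMap.rTensor S (LinearMap.mulLeft R s) t = (s ⊗ₜ 1) * t := by
    induction t with
    | zero => simp
    | tmul x y => simp
    | add x y hx hy => simp [mul_add, hx, hy]
  have h2 (t : S ⊗[R] S) (s : S) :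
      LinearMap.lTensor S (LinearMap.mulRight R s) t = (1 ⊗ₜ s) * t := by
    induction t with
    | zero => simp
    | tmul x y => simp [mul_comm]
    | add x y hx hy => simp [mul_add, hx, hy]
  refine exists_congr fun t => ?_
  rw [and_comm]
  refine and_congr (forall_congr' fun s => ?_) Iff.rfl
  rw [h1, h2, sub_mul, sub_eq_zero, eq_comm]

theorem isFiniteEtale_iff {R S : Type*} [CommRing R] [CommRing S] [Algebra R S] :
    IsFiniteEtale R S ↔ Module.Finite R S ∧ Algebra.Etale R S := by
  unfold IsFiniteEtale
  rw [isSep_iff]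
  constructor
  · rintro ⟨h1, h2, h3⟩
    refine ⟨h1, ?_⟩
    have : Module.FinitePresentation R S := Module.finitePresentation_of_projective R S
    have : Algebra.FinitePresentation R S :=
      (Module.FinitePresentation.iff_finitePresentation_of_finite R S).1 this
    have : Algebra.FormallyUnramified R S :=
      Algebra.FormallyUnramified.iff_exists_tensorProduct.2 h3
    exact Algebra.Etale.of_formallyUnramified_of_flat
  · rintro ⟨h1, h2⟩
    exact ⟨h1, proj_of_etale R S, Algebra.FormallyUnramified.iff_exists_tensorProduct.1 inferInstance⟩

theorem IsConnectedRing.nontrivial {R : Type*} [CommRing R] (h : IsConnectedRing R) :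
    Nontrivial R := ⟨0, 1, h.1⟩

theorem IsConnectedRing.rank_const {R : Type*} [CommRing R] (h : IsConnectedRing R)
    (M : Type*) [AddCommGroup M] [Module R M] [Module.Finite R M] [Module.Projective R M] :
    ∃ k : ℕ, Module.rankAtStalk (R := R) M = k := by
  have := h.nontrivial
  have : Module.FinitePresentation R M := Module.finitePresentation_of_projective R M
  have hl : IsLocallyConstant (Module.rankAtStalk (R := R) M) :=
    Module.isLocallyConstant_rankAtStalk
  have hp : PreconnectedSpace (PrimeSpectrum R) := by
    rw [preconnectedSpace_iff_clopen]
    intro s hs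
    obtain ⟨⟨e, he⟩, hes⟩ := PrimeSpectrum.isIdempotentElemEquivClopens.surjective
      (⟨s, hs⟩ : TopologicalSpace.Clopens (PrimeSpectrum R))
    have h4 := PrimeSpectrum.coe_isIdempotentElemEquivClopens_apply (R := R) ⟨e, he⟩
    rw [hes] at h4
    have h5 : s = (PrimeSpectrum.basicOpen e : Set (PrimeSpectrum R)) := h4
    rcases h.2 e he with rfl | rfl
    · left; rw [h5]; simp
    · right; rw [h5]; simp
  obtain ⟨x⟩ : Nonempty (PrimeSpectrum R) := inferInstance
  refine ⟨Module.rankAtStalk M x, funext fun y => ?_⟩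
  simpa using hl.apply_eq_of_preconnectedSpace y x

attribute [local instance] Algebra.TensorProduct.rightAlgebra in
theorem rank_tower {R T M : Type} [CommRing R] [CommRing T] [Algebra R T] [AddCommGroup M]
    [Module R M] [Module T M] [IsScalarTower R T M] [Module.Finite R T] [Module.Projective R T]
    [Module.Finite T M] [Module.Projective T M] {k a : ℕ}
    (hk : Module.rankAtStalk (R := R) T = k) (ha : Module.rankAtStalk (R := T) M = a) :
    Module.rankAtStalk (R := R) M = ((k * a : ℕ) : PrimeSpectrum R → ℕ) := by
  have : Module.Finite R M := Module.Finite.trans T M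
  have : Module.Flat R M := Module.Flat.trans R T M
  ext p
  let K := p.asIdeal.ResidueField
  let A := K ⊗[R] T
  have hKp : PrimeSpectrum.comap (algebraMap R K) ⊥ = p := by
    ext x
    simp [K]
  have h1 : Module.finrank K A = k := by
    have h := Module.rankAtStalk_baseChange (R := R) (M := T) (S := K) ⊥
    rw [Module.rankAtStalk_eq_finrank_of_free, hk] at h
    simpa using h
  have h3 : Module.finrank K (K ⊗[R] M) = Module.rankAtStalk (R := R) M p := by
    have h := Module.rankAtStalk_baseChange (R := R) (M := M) (S := K) ⊥
    rw [Module.rankAtStalk_eq_finrank_of_free, hKp] at h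
    simpa using h
  have hArt : IsArtinianRing A := isArtinian_of_tower K inferInstance
  have h2 : Nonempty (Module.Basis (Fin a) A (A ⊗[T] M)) := by
    apply Module.nonempty_basis_of_flat_of_finrank_eq
    intro P
    have := P.2
    let : Field (A ⧸ P.1) := Ideal.Quotient.field P.1
    have h := Module.rankAtStalk_baseChange (R := A) (M := A ⊗[T] M) (S := A ⧸ P.1) ⊥
    rw [Module.rankAtStalk_eq_finrank_of_free, Module.rankAtStalk_baseChange, ha] at h
    simpa using h
  obtain ⟨b⟩ := h2
  let e : A ⊗[T] M ≃ₗ[K] K ⊗[R] M := Algebra.IsPushout.cancelBaseChange R K T A M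
  rw [← h3, ← e.finrank_eq]
  rcases subsingleton_or_nontrivial A with hA | hA
  · have : Subsingleton (A ⊗[T] M) := b.repr.toEquiv.subsingleton
    rw [Module.finrank_zero_of_subsingleton] at h1 ⊢
    simp [← h1]
  have := Module.Free.of_basis b
  rw [← Module.finrank_mul_finrank K A (A ⊗[T] M), h1, Module.finrank_eq_card_basis b]
  simp

theorem etale_quot {R B : Type} [CommRing R] [CommRing B] [Algebra R B]
    [Algebra.Etale R B] {e : B} (he : IsIdempotentElem e) :
    Algebra.Etale R (B ⧸ Ideal.span {e}) := by
  have h : IsLocalization.Away (1 - e) (B ⧸ Ideal.span {e}) := by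
    have := IsLocalization.away_of_isIdempotentElem (R := B) (S := B ⧸ Ideal.span {e})
      (e := 1 - e) he.one_sub (by simp) Ideal.Quotient.mk_surjective
    exact this
  have : Algebra.Etale B (B ⧸ Ideal.span {e}) := Algebra.Etale.of_isLocalizationAway (1 - e)
  exact Algebra.Etale.comp R B _

theorem rank_split {R B : Type} [CommRing R] [CommRing B] [Algebra R B] [Module.Finite R B]
    [Algebra.Etale R B] {e : B} (he : IsIdempotentElem e) :
    Module.rankAtStalk (R := R) B = Module.rankAtStalk (R := R) (B ⧸ Ideal.span {e}) +
      Module.rankAtStalk (R := R) (B ⧸ Ideal.span {1 - e}) := by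
  have := etale_quot (R := R) he
  have := etale_quot (R := R) he.one_sub
  let E := AlgEquiv.prodQuotientOfIsIdempotentElem R he he.one_sub (by simp) (by simp [he])
  rw [Module.rankAtStalk_eq_of_equiv E.toLinearEquiv, Module.rankAtStalk_prod]

theorem subsing_of_rank {R B : Type} [CommRing R] [CommRing B] [Algebra R B] [Module.Finite R B]
    [Algebra.Etale R B] {e : B}
    (h : Module.rankAtStalk (R := R) (B ⧸ Ideal.span {e}) = ((0 : ℕ) : PrimeSpectrum R → ℕ))
    (he : IsIdempotentElem e) : e = 1 := by
  have := etale_quot (R := R) he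
  rw [Nat.cast_zero, Module.rankAtStalk_eq_zero_iff_subsingleton] at h
  rw [Ideal.Quotient.subsingleton_iff, Ideal.span_singleton_eq_top] at h
  exact (IsIdempotentElem.iff_eq_one_of_isUnit h).1 he

theorem exists_odd_component {R : Type} [CommRing R] (hR : IsConnectedRing R) (k : ℕ) (hk : Odd k) :
    ∀ (B : Type) [CommRing B] [Algebra R B] [Module.Finite R B] [Algebra.Etale R B],
      Module.rankAtStalk (R := R) B = (k : PrimeSpectrum R → ℕ) →
    ∃ (T : Type) (_ : CommRing T) (_ : Algebra R T), Module.Finite R T ∧ Algebra.Etale R T ∧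
      IsConnectedRing T ∧ (∃ k' : ℕ, Odd k' ∧
        Module.rankAtStalk (R := R) T = (k' : PrimeSpectrum R → ℕ)) ∧
      Nonempty (B →ₐ[R] T) := by
  have := hR.nontrivial
  obtain ⟨x⟩ : Nonempty (PrimeSpectrum R) := inferInstance
  induction k using Nat.strong_induction_on with
  | _ k ih =>
    intro B _ _ _ _ hB
    by_cases hc : IsConnectedRing B
    · exact ⟨B, inferInstance, inferInstance, inferInstance, inferInstance, hc, ⟨k, hk, hB⟩,
        ⟨AlgHom.id R B⟩⟩
    have hnt : Nontrivial B := by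
      apply Module.nontrivial_of_rankAtStalk_pos (R := R)
      rw [hB]
      refine Pi.lt_def.2 ⟨fun i => Nat.zero_le _, x, ?_⟩
      simpa using hk.pos
    have : ∃ e : B, IsIdempotentElem e ∧ e ≠ 0 ∧ e ≠ 1 := by
      by_contra hcon
      push Not at hcon
      refine hc ⟨zero_ne_one, fun e he => ?_⟩
      by_cases h0 : e = 0
      · exact Or.inl h0
      · exact Or.inr (hcon e he h0)
    obtain ⟨e, he, he0, he1⟩ := this
    have i1 := etale_quot (R := R) he
    have i2 := etale_quot (R := R) he.one_sub
    have := proj_of_etale R (B ⧸ Ideal.span {e})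
    have := proj_of_etale R (B ⧸ Ideal.span {1 - e})
    obtain ⟨a, ha⟩ := hR.rank_const (B ⧸ Ideal.span {e})
    obtain ⟨b, hb⟩ := hR.rank_const (B ⧸ Ideal.span {1 - e})
    have hab : k = a + b := by
      have h := congrFun (rank_split (R := R) he) x
      rw [hB, ha, hb] at h
      simpa using h
    have ha0 : a ≠ 0 := fun h => he1 (subsing_of_rank (h ▸ ha) he)
    have hb0 : b ≠ 0 := fun h => he0 (by
      have := subsing_of_rank (h ▸ hb) he.one_sub
      simpa using this)
    rcases Nat.even_or_odd a with hae | hao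
    · have hbo : Odd b := by
        rw [hab] at hk
        exact (Nat.odd_add'.1 hk).2 hae
      obtain ⟨T, i1, i2, h1, h2, h3, h4, ⟨f⟩⟩ := ih b (by omega) hbo (B ⧸ Ideal.span {1 - e}) hb
      exact ⟨T, i1, i2, h1, h2, h3, h4, ⟨f.comp (Ideal.Quotient.mkₐ R _)⟩⟩
    · obtain ⟨T, i1, i2, h1, h2, h3, h4, ⟨f⟩⟩ := ih a (by omega) hao (B ⧸ Ideal.span {e}) ha
      exact ⟨T, i1, i2, h1, h2, h3, h4, ⟨f.comp (Ideal.Quotient.mkₐ R _)⟩⟩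

attribute [local instance] Algebra.TensorProduct.rightAlgebra in
theorem connected_tensor {R T S : Type} [CommRing R] [CommRing T] [CommRing S] [Algebra R T]
    [Algebra R S] [Module.Finite R T] [Module.Finite R S] [Algebra.Etale R T] [Algebra.Etale R S]
    (hR : IsConnectedRing R)
    (hT : IsConnectedRing T) (hS : IsConnectedRing S) {k m : ℕ} (hm0 : m ≠ 0) (hkm : Nat.Coprime k m)
    (hk : Module.rankAtStalk (R := R) T = (k : PrimeSpectrum R → ℕ))
    (hm : Module.rankAtStalk (R := R) S = (m : PrimeSpectrum R → ℕ)) :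
    IsConnectedRing (T ⊗[R] S) := by
  have := hT.nontrivial
  have := hR.nontrivial
  obtain ⟨x⟩ : Nonempty (PrimeSpectrum T) := inferInstance
  obtain ⟨y⟩ : Nonempty (PrimeSpectrum R) := inferInstance
  have hrk : Module.rankAtStalk (R := T) (T ⊗[R] S) = (m : PrimeSpectrum T → ℕ) := by
    ext p
    rw [Module.rankAtStalk_baseChange, hm]; rfl
  have hnt : Nontrivial (T ⊗[R] S) := by
    apply Module.nontrivial_of_rankAtStalk_pos (R := T)
    rw [hrk]
    refine Pi.lt_def.2 ⟨fun i => Nat.zero_le _, x, ?_⟩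
    simpa using Nat.pos_of_ne_zero hm0
  have key (e : T ⊗[R] S) (he : IsIdempotentElem e) : ∃ a : ℕ, m ∣ a ∧
      Module.rankAtStalk (R := T) ((T ⊗[R] S) ⧸ Ideal.span {e}) = (a : PrimeSpectrum T → ℕ) := by
    let E : S ⊗[R] T ≃ₐ[S] T ⊗[R] S :=
      AlgEquiv.ofRingEquiv (f := (Algebra.TensorProduct.comm R S T).toRingEquiv) (by
        intro s; simp [RingHom.algebraMap_toAlgebra])
    have : Algebra.Etale S (T ⊗[R] S) := Algebra.Etale.of_equiv (A := S ⊗[R] T) E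
    have : Module.Finite S (T ⊗[R] S) := Module.Finite.equiv E.toLinearEquiv
    have := etale_quot (R := T) he
    have := etale_quot (R := S) he
    have := proj_of_etale T ((T ⊗[R] S) ⧸ Ideal.span {e})
    have := proj_of_etale S ((T ⊗[R] S) ⧸ Ideal.span {e})
    have := proj_of_etale R T
    have := proj_of_etale R S
    obtain ⟨a, ha⟩ := hT.rank_const ((T ⊗[R] S) ⧸ Ideal.span {e})
    obtain ⟨b, hb⟩ := hS.rank_const ((T ⊗[R] S) ⧸ Ideal.span {e})
    refine ⟨a, ?_, ha⟩
    have h1 := rank_tower hk ha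
    have h2 := rank_tower hm hb
    have h3 : k * a = m * b := by
      have := congrFun (h1.symm.trans h2) y
      simpa using this
    exact hkm.symm.dvd_of_dvd_mul_left ⟨b, h3⟩
  refine ⟨zero_ne_one, fun e he => ?_⟩
  obtain ⟨a, ha, ha'⟩ := key e he
  obtain ⟨b, hb, hb'⟩ := key (1 - e) he.one_sub
  have hab : m = a + b := by
    have h := congrFun (rank_split (R := T) he) x
    rw [hrk, ha', hb'] at h
    simpa using h
  by_cases ha0 : a = 0
  · right
    exact subsing_of_rank (ha0 ▸ ha') he
  · left
    have : m ≤ a := Nat.le_of_dvd (Nat.pos_of_ne_zero ha0) ha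
    have hb0 : b = 0 := by omega
    simpa using subsing_of_rank (hb0 ▸ hb') he.one_sub

/-- pair -/
abbrev tpair {R S A : Type} [CommRing R] [CommRing S] [Algebra R S] [CommRing A] [Algebra R A]
    (u w : S →ₐ[R] A) : S ⊗[R] S →ₐ[R] A := Algebra.TensorProduct.lift u w (fun _ _ => Commute.all _ _)

theorem tpair_comp {R S A A' : Type} [CommRing R] [CommRing S] [Algebra R S] [CommRing A] [Algebra R A]
    [CommRing A'] [Algebra R A']
    (u w : S →ₐ[R] A) (f : A →ₐ[R] A') (t : S ⊗[R] S) :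
    tpair (f.comp u) (f.comp w) t = f (tpair u w t) := by
  have : tpair (f.comp u) (f.comp w) = f.comp (tpair u w) := by
    ext <;> simp
  rw [this]; rfl

theorem tpair_self {R S A : Type} [CommRing R] [CommRing S] [Algebra R S] [CommRing A] [Algebra R A]
    (u : S →ₐ[R] A) (t : S ⊗[R] S) :
    tpair u u t = u (Algebra.TensorProduct.lmul' R t) := by
  have : tpair u u = u.comp (Algebra.TensorProduct.lmul' R) := by
    ext <;> simp
  rw [this]; rfl

theorem tpair_swap {R S A : Type} [CommRing R] [CommRing S] [Algebra R S] [CommRing A] [Algebra R A]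
    (u w : S →ₐ[R] A) {t : S ⊗[R] S}
    (ht : ∀ s, ((1 : S) ⊗ₜ[R] s - s ⊗ₜ[R] (1 : S)) * t = 0) (s : S) :
    tpair u w t * u s = tpair u w t * w s := by
  have := congrArg (tpair u w) (ht s)
  simp only [map_mul, map_sub, Algebra.TensorProduct.lift_tmul, map_one, one_mul, mul_one, map_zero] at this
  linear_combination -this

theorem tpair_absorb {R S A : Type} [CommRing R] [CommRing S] [Algebra R S] [CommRing A] [Algebra R A]
    (u w : S →ₐ[R] A) (t : S ⊗[R] S) (c : A) (hc : ∀ s, c * u s = c * w s) :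
    c * tpair u w t = c * u (Algebra.TensorProduct.lmul' R t) := by
  induction t with
  | zero => simp
  | add x y hx hy => simp only [map_add, mul_add, hx, hy]
  | tmul x y =>
    simp only [Algebra.TensorProduct.lift_tmul, Algebra.TensorProduct.lmul'_apply_tmul, map_mul]
    linear_combination - u x * hc y

theorem exists_univ (R S : Type) [CommRing R] [CommRing S] [Algebra R S] (m : ℕ) (t : S ⊗[R] S) :
    ∃ (E : Type) (_ : CommRing E) (_ : Algebra R E) (φ : Fin m → S →ₐ[R] E),
      (∀ i j, i ≠ j → tpair (φ i) (φ j) t = 0) ∧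
      (∀ U : Subalgebra R E, (∀ i s, φ i s ∈ U) → U = ⊤) ∧
      (∀ (A : Type) [CommRing A] [Algebra R A] (v : Fin m → S →ₐ[R] A),
        (∀ i j, i ≠ j → tpair (v i) (v j) t = 0) → ∃ f : E →ₐ[R] A, ∀ i, f.comp (φ i) = v i) := by
  let P := ⨂[R] _ : Fin m, S
  let ψ : Fin m → S →ₐ[R] P := fun i => PiTensorProduct.singleAlgHom (A := fun _ => S) i
  have lift (A : Type) [CommRing A] [Algebra R A] (v : Fin m → S →ₐ[R] A) :
      ∃ f : P →ₐ[R] A, ∀ i, f.comp (ψ i) = v i := by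
    refine ⟨PiTensorProduct.liftAlgHom ((MultilinearMap.mkPiAlgebra R (Fin m) A).compLinearMap
      (fun i => (v i).toLinearMap)) (by simp) (by simp [Finset.prod_mul_distrib]), fun i => ?_⟩
    ext s
    have h : ∀ x : Fin m → S, PiTensorProduct.lift ((MultilinearMap.mkPiAlgebra R (Fin m) A).compLinearMap
      (fun i => (v i).toLinearMap)) (PiTensorProduct.tprod R x) = ∏ i, v i (x i) := by
      intro x
      rw [PiTensorProduct.lift.tprod]; rfl
    refine (h _).trans ?_
    rw [Finset.prod_eq_single i]
    · simp
    · intro b _ hb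
      simp [Pi.mulSingle_eq_of_ne hb]
    · simp
  let I : Ideal P := Ideal.span {x | ∃ i j, i ≠ j ∧ x = tpair (ψ i) (ψ j) t}
  refine ⟨P ⧸ I, inferInstance, inferInstance, fun i => (Ideal.Quotient.mkₐ R I).comp (ψ i), ?_, ?_, ?_⟩
  · intro i j hij
    rw [tpair_comp]
    exact Ideal.Quotient.eq_zero_iff_mem.2 (Ideal.subset_span ⟨i, j, hij, rfl⟩)
  · intro U hU
    rw [eq_top_iff]
    rintro x -
    obtain ⟨x, rfl⟩ := Ideal.Quotient.mk_surjective x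
    obtain ⟨f, hf⟩ := lift (U.comap (Ideal.Quotient.mkₐ R I))
      (fun i => (ψ i).codRestrict _ (fun s => hU i s))
    have : (Subalgebra.val _).comp f = AlgHom.id R P := by
      apply PiTensorProduct.algHom_ext
      intro i
      have := hf i
      change (Subalgebra.val _).comp (f.comp (ψ i)) = _
      rw [this]
      rfl
    have h2 := DFunLike.congr_fun this x
    have h3 := (f x).2
    rw [show ((f x : _) : P) = x from h2] at h3
    exact h3
  · intro A _ _ v hv
    obtain ⟨f, hf⟩ := lift A v
    refine ⟨Ideal.Quotient.liftₐ I f ?_, fun i => ?_⟩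
    · intro a ha
      have : I ≤ RingHom.ker f := by
        rw [Ideal.span_le]
        rintro x ⟨i, j, hij, rfl⟩
        change f _ = 0
        rw [← tpair_comp, hf, hf, hv i j hij]
      exact this ha
    · rw [← hf i]
      ext s
      rfl

theorem exists_orth (R S : Type) [CommRing R] [CommRing S] [Algebra R S] [Module.Finite R S]
    [Algebra.Etale R S] {m : ℕ} (hR : IsConnectedRing R)
    (hm : Module.rankAtStalk (R := R) S = (m : PrimeSpectrum R → ℕ))
    {t : S ⊗[R] S}
    (ht : ∀ s, ((1 : S) ⊗ₜ[R] s - s ⊗ₜ[R] (1 : S)) * t = 0) :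
    ∃ (V : Type) (_ : CommRing V) (_ : Algebra R V) (v : Fin m → S →ₐ[R] V) (e : Fin m → V ⊗[R] S),
      Module.FaithfullyFlat R V ∧
      (∀ i j, i ≠ j → tpair (v i) (v j) t = 0) ∧ (∑ i, e i = 1) ∧
      (∀ i s, e i * ((1 : V) ⊗ₜ s) = e i * (v i s ⊗ₜ 1)) := by
  obtain ⟨V, _, _, _, _, _, hV⟩ := Algebra.IsFiniteSplit.exists_tensorProduct_of_etale hm
  have := hR.nontrivial
  have hVn : Nontrivial V := (FaithfulSMul.algebraMap_injective R V).nontrivial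
  obtain ⟨x⟩ : Nonempty (PrimeSpectrum V) := inferInstance
  obtain ⟨m', ⟨F⟩⟩ := hV.nonempty_algEquiv_fun
  have hmm : m' = m := by
    have h1 : Module.rankAtStalk (R := V) (V ⊗[R] S) = (m : PrimeSpectrum V → ℕ) := by
      ext p
      rw [Module.rankAtStalk_baseChange, hm]; rfl
    rw [Module.rankAtStalk_eq_of_equiv F.toLinearEquiv] at h1
    have := congrFun h1 x
    rw [Module.rankAtStalk_eq_finrank_of_free] at this
    simpa using this
  subst hmm
  let p (i : Fin m') : V ⊗[R] S →ₐ[V] V := (Pi.evalAlgHom V (fun _ => V) i).comp F.toAlgHom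
  let v (i : Fin m') : S →ₐ[R] V := ((p i).restrictScalars R).comp Algebra.TensorProduct.includeRight
  have hp (i x y) : p i (x ⊗ₜ y) = x * v i y := by
    have : (x ⊗ₜ[R] y : V ⊗[R] S) = algebraMap V _ x * ((1 : V) ⊗ₜ y) := by simp
    rw [this, map_mul, AlgHom.commutes]; rfl
  refine ⟨V, inferInstance, inferInstance, v, fun i => F.symm (Pi.single i 1), inferInstance, ?_, ?_, ?_⟩
  · intro i j hij
    have key (x : V ⊗[R] S) : tpair (v i) (v j) t * p i x = tpair (v i) (v j) t * p j x := by
      induction x with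
      | zero => simp
      | add x y hx hy => simp only [map_add, mul_add, hx, hy]
      | tmul x y =>
        rw [hp, hp]
        linear_combination x * tpair_swap (v i) (v j) ht y
    have := key (F.symm (Pi.single i 1))
    simpa [p, hij.symm] using this
  · apply F.injective
    simp only [map_sum, AlgEquiv.apply_symm_apply, map_one]
    exact Finset.univ_sum_single 1
  · intro i s
    apply F.injective
    ext j
    simp only [map_mul, AlgEquiv.apply_symm_apply, Pi.mul_apply]
    change _ * p j _ = _ * p j _
    rw [hp, hp]
    by_cases h : j = i
    · subst h; simp
    · simp [h]

theorem descend_elt {R V E : Type} [CommRing R] [CommRing V] [CommRing E] [Algebra R V] [Algebra R E]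
    [Module.FaithfullyFlat R V] (b : E) (c : V) (h : (1 : V) ⊗ₜ[R] b = c ⊗ₜ[R] (1 : E)) :
    ∃ r, algebraMap R E r = b := by
  let N : Submodule R E := LinearMap.range (Algebra.linearMap R E)
  have h1 : (1 : V) ⊗ₜ[R] (N.mkQ b) = 0 := by
    have := congrArg (LinearMap.lTensor V N.mkQ) h
    simp only [LinearMap.lTensor_tmul] at this
    rw [this]
    have h0 : N.mkQ (1 : E) = 0 := by
      rw [Submodule.mkQ_apply, Submodule.Quotient.mk_eq_zero]
      exact ⟨1, by simp⟩
    rw [h0, tmul_zero]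
  have h2 : N.mkQ b = 0 := by
    apply Module.FaithfullyFlat.tensorProduct_mk_injective (A := R) (B := V) (E ⧸ N)
    simpa using h1
  rw [Submodule.mkQ_apply, Submodule.Quotient.mk_eq_zero] at h2
  exact h2

theorem exists_galois (R S : Type) [CommRing R] [CommRing S] [Algebra R S] [Module.Finite R S]
    [Algebra.Etale R S] {m : ℕ} (hR : IsConnectedRing R)
    (hm : Module.rankAtStalk (R := R) S = (m : PrimeSpectrum R → ℕ))
    {t : S ⊗[R] S}
    (ht : ∀ s, ((1 : S) ⊗ₜ[R] s - s ⊗ₜ[R] (1 : S)) * t = 0) (ht1 : Algebra.TensorProduct.lmul' R t = 1) :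
    ∃ (E : Type) (_ : CommRing E) (_ : Algebra R E) (_ : MulSemiringAction (Equiv.Perm (Fin m)) E)
      (φ : Fin m → S →ₐ[R] E),
      (∀ i j, i ≠ j → tpair (φ i) (φ j) t = 0) ∧
      (∀ (g : Equiv.Perm (Fin m)) (r : R), g • algebraMap R E r = algebraMap R E r) ∧
      (∀ (g : Equiv.Perm (Fin m)) i s, g • φ i s = φ (g i) s) ∧
      (∀ b : E, (∀ g : Equiv.Perm (Fin m), g • b = b) → ∃ r, algebraMap R E r = b) ∧
      Function.Injective (algebraMap R E) ∧
      (∃ D : Finset (E × E), ∀ g : Equiv.Perm (Fin m),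
        ∑ k ∈ D, k.1 * g • k.2 = if g = 1 then 1 else 0) := by
  obtain ⟨E, _, _, φ, horth, hgen, huniv⟩ := exists_univ R S m t
  have hext {A : Type} [CommRing A] [Algebra R A] (f g : E →ₐ[R] A)
      (h : ∀ i s, f (φ i s) = g (φ i s)) : f = g := by
    have := hgen (AlgHom.equalizer f g) (fun i s => h i s)
    ext x
    have hx : x ∈ AlgHom.equalizer f g := this ▸ Algebra.mem_top
    exact hx
  have hρ (σ : Equiv.Perm (Fin m)) : ∃ f : E →ₐ[R] E, ∀ i, f.comp (φ i) = φ (σ i) :=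
    huniv E (fun i => φ (σ i)) (fun i j hij => horth _ _ (fun h => hij (σ.injective h)))
  choose ρ hρ using hρ
  have hρ' (σ i s) : ρ σ (φ i s) = φ (σ i) s := DFunLike.congr_fun (hρ σ i) s
  have hρ1 : ρ 1 = AlgHom.id R E := hext _ _ fun i s => by rw [hρ']; rfl
  have hρm (σ τ) : ρ (σ * τ) = (ρ σ).comp (ρ τ) := hext _ _ fun i s => by
    rw [hρ', AlgHom.comp_apply, hρ', hρ']; rfl
  let act : MulSemiringAction (Equiv.Perm (Fin m)) E :=
    { smul := fun g x => ρ g x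
      one_smul := fun x => by change ρ 1 x = x; rw [hρ1]; rfl
      mul_smul := fun g h x => by change ρ (g * h) x = _; rw [hρm]; rfl
      smul_zero := fun g => map_zero (ρ g)
      smul_add := fun g => map_add (ρ g)
      smul_one := fun g => map_one (ρ g)
      smul_mul := fun g => map_mul (ρ g) }
  have hact (g : Equiv.Perm (Fin m)) (x : E) : g • x = ρ g x := rfl
  obtain ⟨V, _, _, v, e, hff, hv, hsum, he⟩ := exists_orth R S hR hm ht
  obtain ⟨f, hf⟩ := huniv V v hv
  refine ⟨E, inferInstance, inferInstance, act, φ, horth, fun g r => AlgHom.commutes _ _,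
    fun g i s => hρ' _ _ _, ?_, ?_, ?_⟩
  · intro b hb
    apply descend_elt (V := V) b (f b)
    let inE : E →ₐ[R] V ⊗[R] E := Algebra.TensorProduct.includeRight
    let inV : V →ₐ[R] V ⊗[R] E := Algebra.TensorProduct.includeLeft
    let Φ (j : Fin m) : V ⊗[R] S →ₐ[R] V ⊗[R] E := Algebra.TensorProduct.map (AlgHom.id R V) (φ j)
    let d (i j : Fin m) : V ⊗[R] E := Φ j (e i)
    have hd (i j s) : d i j * inE (φ j s) = d i j * inV (v i s) := by
      have := congrArg (Φ j) (he i s)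
      simpa [Φ, d, inE, inV, map_mul] using this
    have hdsum (j) : ∑ i, d i j = 1 := by
      simp only [d]
      rw [← map_sum, hsum, map_one]
    have hdd (i j k) (hjk : j ≠ k) : d i j * d i k = 0 := by
      have h1 := tpair_absorb (inE.comp (φ j)) (inE.comp (φ k)) t (d i j * d i k) (by
        intro s
        simp only [AlgHom.comp_apply]
        linear_combination d i k * hd i j s - d i j * hd i k s)
      rw [tpair_comp, horth j k hjk, ht1] at h1
      simpa using h1.symm
    have hF (w : Fin m → Fin m) : (∏ j, d (w j) j) * inE b = (∏ j, d (w j) j) * inV (f b) := by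
      by_cases hw : Function.Injective w
      · let σ : Equiv.Perm (Fin m) := Equiv.ofBijective w (Finite.injective_iff_bijective.1 hw)
        have hb' : f b = (f.comp (ρ σ)) b := by
          rw [AlgHom.comp_apply, ← hact, hb]
        rw [hb']
        let U : Subalgebra R E :=
          { carrier := {x | (∏ j, d (w j) j) * inE x = (∏ j, d (w j) j) * inV ((f.comp (ρ σ)) x)}
            mul_mem' := by
              intro x y hx hy
              simp only [Set.mem_ofPred_eq, map_mul] at *
              linear_combination inE y * hx + inV ((f.comp (ρ σ)) x) * hy
            add_mem' := by
              intro x y hx hy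
              simp only [Set.mem_ofPred_eq, map_add] at *
              linear_combination hx + hy
            algebraMap_mem' := by
              intro r
              simp only [Set.mem_ofPred_eq, AlgHom.commutes] }
        have hU : U = ⊤ := hgen U (by
          intro i s
          change _ * _ = _ * _
          have h1 : (f.comp (ρ σ)) (φ i s) = v (w i) s := by
            rw [AlgHom.comp_apply, hρ']
            exact DFunLike.congr_fun (hf _) s
          rw [h1, ← Finset.mul_prod_erase _ _ (Finset.mem_univ i)]
          linear_combination (∏ x ∈ Finset.univ.erase i, d (w x) x) * hd (w i) i s)
        have : b ∈ U := hU ▸ Algebra.mem_top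
        exact this
      · have : ∏ j, d (w j) j = 0 := by
          simp only [Function.Injective] at hw
          push Not at hw
          obtain ⟨j, k, hjk, hne⟩ := hw
          rw [← Finset.mul_prod_erase _ _ (Finset.mem_univ j), ← Finset.mul_prod_erase _ _
            (Finset.mem_erase.2 ⟨hne.symm, Finset.mem_univ k⟩), ← mul_assoc, hjk, hdd _ _ _ hne, zero_mul]
        rw [this, zero_mul, zero_mul]
    have h1 : (1 : V ⊗[R] E) = ∑ w : Fin m → Fin m, ∏ j, d (w j) j := by
      rw [← Fintype.piFinset_univ, ← Finset.prod_univ_sum (fun _ => Finset.univ) (fun j i => d i j)]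
      simp [hdsum]
    change inE b = inV (f b)
    rw [← one_mul (inE b), ← one_mul (inV (f b)), h1, Finset.sum_mul, Finset.sum_mul]
    exact Finset.sum_congr rfl fun w _ => hF w
  · have : Function.Injective (algebraMap R V) := FaithfulSMul.algebraMap_injective R V
    intro a b hab
    apply this
    rw [← f.commutes, ← f.commutes, hab]
  · let T : E ⊗[R] E := ∏ j, tpair ((Algebra.TensorProduct.includeLeft : E →ₐ[R] E ⊗[R] E).comp (φ j))
      ((Algebra.TensorProduct.includeRight : E →ₐ[R] E ⊗[R] E).comp (φ j)) t
    obtain ⟨D, hD⟩ := TensorProduct.exists_finset T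
    refine ⟨D, fun g => ?_⟩
    let μ : E ⊗[R] E →ₐ[R] E := tpair (AlgHom.id R E) (ρ g)
    have h1 : ∑ k ∈ D, k.1 * g • k.2 = μ T := by
      rw [hD, map_sum]
      simp [μ, hact]
    rw [h1]
    have h2 : μ T = ∏ j, tpair (φ j) (φ (g j)) t := by
      simp only [T, map_prod]
      refine Finset.prod_congr rfl fun j _ => ?_
      rw [← tpair_comp]
      congr 2
      · ext s; simp [μ]
      · ext s; simp [μ, hρ']
    rw [h2]
    split_ifs with hg
    · subst hg
      refine Finset.prod_eq_one fun j _ => ?_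
      rw [Equiv.Perm.one_apply, tpair_self, ht1, map_one]
    · obtain ⟨j, hj⟩ : ∃ j, g j ≠ j := by
        by_contra hcon
        push Not at hcon
        exact hg (Equiv.ext hcon)
      exact Finset.prod_eq_zero (Finset.mem_univ j) (horth _ _ hj.symm)

/-- Galois extension data -/
structure GalHyp (G A C : Type) [Group G] [DecidableEq G] [CommRing A] [CommRing C] [Algebra A C]
    (ρ : G → C →+* C) : Prop where
  one : ∀ c, ρ 1 c = c
  mul : ∀ g h c, ρ (g * h) c = ρ g (ρ h c)
  fix : ∀ g a, ρ g (algebraMap A C a) = algebraMap A C a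
  inv : ∀ c, (∀ g, ρ g c = c) → ∃ a, algebraMap A C a = c
  inj : Function.Injective (algebraMap A C)
  dual : ∃ D : Finset (C × C), ∀ g, ∑ k ∈ D, k.1 * ρ g k.2 = if g = 1 then 1 else 0

theorem trace_fix {G C : Type} [Group G] [Fintype G] [CommRing C] (ρ : G → C →+* C)
    (mul : ∀ g h c, ρ (g * h) c = ρ g (ρ h c)) (g : G) (c : C) :
    ρ g (∑ h, ρ h c) = ∑ h, ρ h c := by
  rw [map_sum]
  simp_rw [← mul]
  exact Fintype.sum_equiv (Equiv.mulLeft g) _ _ (fun _ => rfl)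

theorem GalHyp.exists_trace {G A C : Type} [Group G] [Fintype G] [DecidableEq G] [CommRing A] [CommRing C]
    [Algebra A C] {ρ : G → C →+* C} (H : GalHyp G A C ρ) :
    ∃ Tr : C →ₗ[A] A, ∀ c, algebraMap A C (Tr c) = ∑ h, ρ h c := by
  choose f hf using fun c => H.inv (∑ h, ρ h c) (fun g => trace_fix ρ H.mul g c)
  refine ⟨{ toFun := f, map_add' := ?_, map_smul' := ?_ }, hf⟩
  · intro x y
    apply H.inj
    simp [hf, Finset.sum_add_distrib]
  · intro a x
    apply H.inj
    simp [hf, Algebra.smul_def, Finset.mul_sum, H.fix]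

theorem GalHyp.finite_proj {G A C : Type} [Group G] [Fintype G] [DecidableEq G] [CommRing A] [CommRing C]
    [Algebra A C] {ρ : G → C →+* C} (H : GalHyp G A C ρ) :
    Module.Finite A C ∧ Module.Projective A C := by
  obtain ⟨Tr, hTr⟩ := H.exists_trace
  obtain ⟨D, hD⟩ := H.dual
  let i : C →ₗ[A] (D → A) := LinearMap.pi fun k => Tr ∘ₗ (LinearMap.mulLeft A k.1.2)
  let p : (D → A) →ₗ[A] C := Fintype.linearCombination A (fun k : D => k.1.1)
  have hpi : p ∘ₗ i = LinearMap.id := by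
    ext c
    simp only [p, i, LinearMap.comp_apply, Fintype.linearCombination_apply, LinearMap.pi_apply,
      LinearMap.mulLeft_apply, LinearMap.id_apply, Algebra.smul_def, hTr]
    rw [Finset.sum_coe_sort D (fun k => (∑ h, ρ h (k.2 * c)) * k.1)]
    simp_rw [Finset.sum_mul, map_mul]
    rw [Finset.sum_comm]
    have : ∀ g, ∑ k ∈ D, ρ g k.2 * ρ g c * k.1 = if g = 1 then c else 0 := by
      intro g
      have := congrArg (fun x => x * ρ g c) (hD g)
      simp only [Finset.sum_mul] at this
      rw [show (∑ k ∈ D, ρ g k.2 * ρ g c * k.1) = ∑ k ∈ D, k.1 * ρ g k.2 * ρ g c from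
        Finset.sum_congr rfl fun k _ => by ring, this]
      split_ifs with h
      · rw [h, H.one, one_mul]
      · simp
    simp [this]
  refine ⟨Module.Finite.of_surjective p ?_, Module.Projective.of_split i p hpi⟩
  intro c
  exact ⟨i c, DFunLike.congr_fun hpi c⟩

theorem GalHyp.ff {G A C : Type} [Group G] [Fintype G] [DecidableEq G] [CommRing A] [CommRing C]
    [Algebra A C] {ρ : G → C →+* C} (H : GalHyp G A C ρ) : Module.FaithfullyFlat A C := by
  obtain ⟨h1, h2⟩ := H.finite_proj
  have := (faithfulSMul_iff_algebraMap_injective A C).2 H.inj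
  exact Module.FaithfullyFlat.of_comap_surjective (Algebra.IsIntegral.comap_surjective A C)

/-- Equivariant algebra and its invariants -/
structure EqHyp (G A C D F : Type) [Group G] [DecidableEq G] [CommRing A] [CommRing C] [Algebra A C]
    [CommRing D] [Algebra C D] [Algebra A D] [CommRing F] [Algebra A F]
    (ρ : G → C →+* C) (τ : G → D →+* D) (j : F →ₐ[A] D) : Prop where
  one : ∀ c, τ 1 c = c
  mul : ∀ g h c, τ (g * h) c = τ g (τ h c)
  eqv : ∀ g c, τ g (algebraMap C D c) = algebraMap C D (ρ g c)
  fix : ∀ g a, τ g (j a) = j a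
  inv : ∀ c, (∀ g, τ g c = c) → ∃ a, j a = c
  inj : Function.Injective j

/-- comparison map -/
abbrev chrMap {A C D F : Type} [CommRing A] [CommRing C] [Algebra A C]
    [CommRing D] [Algebra C D] [Algebra A D] [IsScalarTower A C D] [CommRing F] [Algebra A F]
    (j : F →ₐ[A] D) : C ⊗[A] F →ₐ[C] D :=
  Algebra.TensorProduct.lift (Algebra.ofId C D) j (fun _ _ => Commute.all _ _)

theorem chr {G A C D F : Type} [Group G] [Fintype G] [DecidableEq G] [CommRing A] [CommRing C] [Algebra A C]
    [CommRing D] [Algebra C D] [Algebra A D] [IsScalarTower A C D] [CommRing F] [Algebra A F]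
    {ρ : G → C →+* C} {τ : G → D →+* D} {j : F →ₐ[A] D} (H : GalHyp G A C ρ)
    (K : EqHyp G A C D F ρ τ j) : Function.Bijective (chrMap (C := C) j) := by
  obtain ⟨Tr, hTr⟩ := H.exists_trace
  obtain ⟨Δ, hΔ⟩ := H.dual
  choose tr htr using fun c => K.inv (∑ h, τ h c) (fun g => trace_fix τ K.mul g c)
  have tr_add (x y) : tr (x + y) = tr x + tr y := by
    apply K.inj
    simp [htr, Finset.sum_add_distrib]
  have tr_zero : tr 0 = 0 := by
    apply K.inj
    simp [htr]
  have key (g : G) (d : D) : ∑ k ∈ Δ, algebraMap C D k.1 * τ g (algebraMap C D k.2 * d)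
      = if g = 1 then d else 0 := by
    have := congrArg (fun x => algebraMap C D x * τ g d) (hΔ g)
    simp only [map_sum, Finset.sum_mul] at this
    rw [show (∑ k ∈ Δ, algebraMap C D k.1 * τ g (algebraMap C D k.2 * d)) =
      ∑ k ∈ Δ, algebraMap C D (k.1 * ρ g k.2) * τ g d from
        Finset.sum_congr rfl fun k _ => by rw [map_mul, K.eqv, map_mul]; ring, this]
    split_ifs with h
    · rw [h, K.one, map_one, one_mul]
    · simp
  let ψ : D → C ⊗[A] F := fun d => ∑ k ∈ Δ, k.1 ⊗ₜ tr (algebraMap C D k.2 * d)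
  have h1 (d) : chrMap (C := C) j (ψ d) = d := by
    simp only [ψ, map_sum, Algebra.TensorProduct.lift_tmul, htr, Algebra.ofId_apply]
    simp_rw [Finset.mul_sum]
    rw [Finset.sum_comm]
    simp_rw [key]
    simp
  have ψ_add (x y) : ψ (x + y) = ψ x + ψ y := by
    simp only [ψ, mul_add, tr_add, tmul_add, Finset.sum_add_distrib]
  have keyC (c : C) : ∑ k ∈ Δ, algebraMap A C (Tr (k.2 * c)) * k.1 = c := by
    simp_rw [hTr, Finset.sum_mul, map_mul]
    rw [Finset.sum_comm]
    have : ∀ g, ∑ k ∈ Δ, ρ g k.2 * ρ g c * k.1 = if g = 1 then c else 0 := by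
      intro g
      have := congrArg (fun x => x * ρ g c) (hΔ g)
      simp only [Finset.sum_mul] at this
      rw [show (∑ k ∈ Δ, ρ g k.2 * ρ g c * k.1) = ∑ k ∈ Δ, k.1 * ρ g k.2 * ρ g c from
        Finset.sum_congr rfl fun k _ => by ring, this]
      split_ifs with h
      · rw [h, H.one, one_mul]
      · simp
    simp [this]
  have h2 (x) : ψ (chrMap (C := C) j x) = x := by
    induction x with
    | zero => simp [ψ, tr_zero]
    | add x y hx hy => rw [map_add, ψ_add, hx, hy]
    | tmul c f =>
      have h3 (k : C × C) : tr (algebraMap C D k.2 * (chrMap (C := C) j (c ⊗ₜ f))) = Tr (k.2 * c) • f := by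
        apply K.inj
        rw [htr, map_smul, Algebra.smul_def, IsScalarTower.algebraMap_apply A C D, hTr, map_sum,
          Finset.sum_mul]
        refine Finset.sum_congr rfl fun g _ => ?_
        simp only [Algebra.TensorProduct.lift_tmul, Algebra.ofId_apply, map_mul, K.eqv, K.fix]
        ring
      simp only [ψ, h3]
      simp_rw [← smul_tmul, ← sum_tmul, Algebra.smul_def, keyC]
  exact ⟨Function.LeftInverse.injective h2, Function.RightInverse.surjective h1⟩

theorem chr_descent {G A C D F : Type} [Group G] [Fintype G] [DecidableEq G] [CommRing A] [CommRing C] [Algebra A C]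
    [CommRing D] [Algebra C D] [Algebra A D] [IsScalarTower A C D] [CommRing F] [Algebra A F]
    {ρ : G → C →+* C} {τ : G → D →+* D} {j : F →ₐ[A] D} (H : GalHyp G A C ρ)
    (K : EqHyp G A C D F ρ τ j) [Module.Finite C D] [Algebra.Etale C D] (r : ℕ)
    (hr : Module.rankAtStalk (R := C) D = (r : PrimeSpectrum C → ℕ)) :
    Module.Finite A F ∧ Algebra.Etale A F ∧
      Module.rankAtStalk (R := A) F = (r : PrimeSpectrum A → ℕ) := by
  have := H.ff
  let e : C ⊗[A] F ≃ₐ[C] D := AlgEquiv.ofBijective _ (chr H K)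
  have i1 : Module.Finite C (C ⊗[A] F) := Module.Finite.equiv e.symm.toLinearEquiv
  have i2 : Algebra.Etale C (C ⊗[A] F) := Algebra.Etale.of_equiv e.symm
  have j1 := Module.Finite.of_finite_tensorProduct_of_faithfullyFlat (R := A) (M := F) C
  have j2 := Algebra.Etale.of_etale_tensorProduct_of_faithfullyFlat (R := A) (S := F) C
  refine ⟨j1, j2, ?_⟩
  ext p
  obtain ⟨q, rfl⟩ := PrimeSpectrum.comap_surjective_of_faithfullyFlat (B := C) p
  rw [← Module.rankAtStalk_baseChange, Module.rankAtStalk_eq_of_equiv e.toLinearEquiv, hr]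
  rfl

/-- twisted action on functions -/
def tw {G L : Type} [Group G] [CommRing L] (ρ : G → L →+* L) (X : Type) [MulAction G X] (g : G) :
    (X → L) →+* (X → L) where
  toFun h := fun x => ρ g (h (g⁻¹ • x))
  map_one' := by ext; simp
  map_mul' := by intros; ext; simp
  map_zero' := by ext; simp
  map_add' := by intros; ext; simp

theorem tw_apply {G L : Type} [Group G] [CommRing L] (ρ : G → L →+* L) (X : Type) [MulAction G X] (g : G)
    (h : X → L) (x : X) : tw ρ X g h x = ρ g (h (g⁻¹ • x)) := rfl

/-- invariant functions -/
def FX {G R L : Type} [Group G] [DecidableEq G] [CommRing R] [CommRing L] [Algebra R L] {ρ : G → L →+* L}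
    (H : GalHyp G R L ρ) (X : Type) [MulAction G X] : Subalgebra R (X → L) where
  carrier := {h | ∀ g, tw ρ X g h = h}
  mul_mem' := by
    intro a b ha hb g
    rw [map_mul, ha g, hb g]
  add_mem' := by
    intro a b ha hb g
    rw [map_add, ha g, hb g]
  algebraMap_mem' := by
    intro r g
    ext x
    exact H.fix g r

section
variable {G R L : Type} [Group G] [DecidableEq G] [CommRing R] [CommRing L]
    [Algebra R L] {ρ : G → L →+* L} (H : GalHyp G R L ρ)

theorem tw_one (H : GalHyp G R L ρ) (X : Type) [MulAction G X] (c : X → L) : tw ρ X 1 c = c := by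
  ext x; simp [tw_apply, H.one]

theorem tw_mul (H : GalHyp G R L ρ) (X : Type) [MulAction G X] (g h : G) (c : X → L) :
    tw ρ X (g * h) c = tw ρ X g (tw ρ X h c) := by
  ext x; simp [tw_apply, H.mul, mul_smul]

theorem eq0 (X : Type) [MulAction G X] :
    EqHyp G R L (X → L) (FX H X) ρ (tw ρ X) (FX H X).val where
  one := tw_one H X
  mul := tw_mul H X
  eqv := by intro g c; rfl
  fix := fun g a => a.2 g
  inv := fun c hc => ⟨⟨c, hc⟩, rfl⟩
  inj := Subtype.val_injective

theorem gal1 (Y : Type) [MulAction G Y] : GalHyp G (FX H Y) (Y → L) (tw ρ Y) where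
  one := tw_one H Y
  mul := tw_mul H Y
  fix := fun g a => a.2 g
  inv := fun c hc => ⟨⟨c, hc⟩, rfl⟩
  inj := Subtype.val_injective
  dual := by
    classical
    obtain ⟨D, hD⟩ := H.dual
    by_cases hY : IsEmpty Y
    · exact ⟨∅, fun g => Subsingleton.elim _ _⟩
    rw [not_isEmpty_iff] at hY
    have hinj : Function.Injective (Function.const Y : L → Y → L) := Function.const_injective
    refine ⟨D.map ⟨fun k => (Function.const Y k.1, Function.const Y k.2), ?_⟩, fun g => ?_⟩
    · intro a b hab
      exact Prod.ext (hinj (Prod.ext_iff.1 hab).1) (hinj (Prod.ext_iff.1 hab).2)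
    · rw [Finset.sum_map]
      ext y
      rw [Finset.sum_apply]
      refine (hD g).trans ?_
      split_ifs <;> rfl

theorem eq1 {Y Z : Type} [MulAction G Y] [MulAction G Z] (π : Z → Y) (hπ : ∀ (g : G) z, π (g • z) = g • π z)
    [Algebra (Y → L) (Z → L)] (hal : ∀ c z, algebraMap (Y → L) (Z → L) c z = c (π z))
    [Algebra (FX H Y) (Z → L)] [Algebra (FX H Y) (FX H Z)]
    (j : FX H Z →ₐ[FX H Y] (Z → L)) (hj : ∀ f, j f = f.1) :
    EqHyp G (FX H Y) (Y → L) (Z → L) (FX H Z) (tw ρ Y) (tw ρ Z) j where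
  one := tw_one H Z
  mul := tw_mul H Z
  eqv := by
    intro g c; ext z
    rw [tw_apply, hal, hal, tw_apply, hπ]
  fix := fun g a => by rw [hj]; exact a.2 g
  inv := fun c hc => ⟨⟨c, hc⟩, hj _⟩
  inj := fun a b hab => Subtype.ext (by rwa [hj, hj] at hab)
end

theorem split_alg {L Y Z I : Type} [CommRing L] [Finite I] (π : Z → Y)
    (e : Z ≃ Y × I) (he : ∀ z, (e z).1 = π z)
    [Algebra (Y → L) (Z → L)] (hal : ∀ c z, algebraMap (Y → L) (Z → L) c z = c (π z)) :
    Module.Finite (Y → L) (Z → L) ∧ Algebra.Etale (Y → L) (Z → L) ∧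
      Module.rankAtStalk (R := Y → L) (Z → L) = ((Nat.card I : ℕ) : PrimeSpectrum (Y → L) → ℕ) := by
  let E : (Z → L) ≃ₐ[Y → L] (I → (Y → L)) := AlgEquiv.ofRingEquiv (f :=
    { toFun := fun h i y => h (e.symm (y, i))
      invFun := fun h z => h (e z).2 (e z).1
      left_inv := by intro h; ext z; simp
      right_inv := by intro h; ext i y; simp
      map_mul' := by intros; rfl
      map_add' := by intros; rfl }) (by
      intro c
      ext i y
      change algebraMap (Y → L) (Z → L) c _ = c y
      rw [hal, ← he]; simp)
  have i1 : Module.Finite (Y → L) (Z → L) := Module.Finite.equiv E.symm.toLinearEquiv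
  have i2 : Algebra.Etale (Y → L) (Z → L) := Algebra.Etale.of_equiv E.symm
  refine ⟨i1, i2, ?_⟩
  rw [Module.rankAtStalk_eq_of_equiv E.toLinearEquiv]
  by_cases hn : Nontrivial (Y → L)
  · ext p
    rw [Module.rankAtStalk_eq_finrank_of_free]
    have := Fintype.ofFinite I
    simp
  · rw [not_nontrivial_iff_subsingleton] at hn
    ext p
    exact (p.2.ne_top (Subsingleton.elim _ _)).elim

/-- pullback -/
def pullHom (L : Type) [CommRing L] {Y Z : Type} (π : Z → Y) : (Y → L) →+* (Z → L) where
  toFun h := h ∘ π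
  map_one' := rfl
  map_mul' := by intros; rfl
  map_zero' := rfl
  map_add' := by intros; rfl

/-- pullback of invariant functions -/
def pullF {G R L : Type} [Group G] [DecidableEq G] [CommRing R] [CommRing L]
    [Algebra R L] {ρ : G → L →+* L} (H : GalHyp G R L ρ) {Y Z : Type} [MulAction G Y] [MulAction G Z]
    (π : Z → Y) (hπ : ∀ (g : G) z, π (g • z) = g • π z) : FX H Y →ₐ[R] FX H Z where
  toFun f := ⟨f.1 ∘ π, by
    intro g
    ext z
    rw [tw_apply]
    have := congrFun (f.2 g) (π z)
    rw [tw_apply] at this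
    simp only [Function.comp_apply, hπ, this]⟩
  map_one' := rfl
  map_mul' := by intros; rfl
  map_zero' := rfl
  map_add' := by intros; rfl
  commutes' := by intros; rfl

theorem bij_aux {R S B C D F : Type} [CommRing R] [CommRing S] [CommRing B] [CommRing C] [CommRing D]
    [CommRing F] [Algebra R S] [Algebra R B] [Algebra B C] [Algebra C D] [Algebra B D] [Algebra B F]
    [IsScalarTower B C D]
    [Module.Finite R S] [Algebra.Etale R S] [Module.Finite C D] [Algebra.Etale C D]
    [Module.FaithfullyFlat B C] {m : ℕ}
    (hm : Module.rankAtStalk (R := R) S = (m : PrimeSpectrum R → ℕ))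
    (hmD : Module.rankAtStalk (R := C) D = (m : PrimeSpectrum C → ℕ))
    (θ : B ⊗[R] S →ₐ[B] F) (j : F →ₐ[B] D)
    (hj : Function.Bijective (chrMap (A := B) (C := C) (D := D) j))
    (hs : Function.Surjective (chrMap (A := B) (C := C) (D := D) (F := B ⊗[R] S) (j.comp θ))) :
    Function.Bijective θ := by
  have hbij : Function.Bijective (chrMap (A := B) (C := C) (D := D) (F := B ⊗[R] S) (j.comp θ)) := by
    refine Module.bijective_of_surjective_of_rankAtStalk_eq (R := C)
      (φ := (chrMap (A := B) (C := C) (D := D) (F := B ⊗[R] S) (j.comp θ)).toLinearMap) hs ?_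
    intro p hp
    rw [hmD, Module.rankAtStalk_baseChange, Module.rankAtStalk_baseChange, hm]
    simp
  have h1 : ⇑(chrMap (A := B) (C := C) (D := D) (F := B ⊗[R] S) (j.comp θ)) =
      ⇑(chrMap (A := B) (C := C) (D := D) j) ∘ ⇑(LinearMap.lTensor C θ.toLinearMap) := by
    ext1 x
    induction x with
    | zero => simp
    | add x y hx hy => simp only [map_add, hx, hy, Function.comp_apply]
    | tmul c x => simp
  rw [h1] at hbij
  exact (Module.FaithfullyFlat.lTensor_bijective_iff_bijective B C θ.toLinearMap).1
    ((Function.Bijective.of_comp_iff' hj _).1 hbij)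

theorem main_alg {R S L : Type} [CommRing R] [CommRing S] [CommRing L] [Algebra R S] [Algebra R L]
    [Module.Finite R S] [Algebra.Etale R S] {m : ℕ}
    (hm : Module.rankAtStalk (R := R) S = (m : PrimeSpectrum R → ℕ))
    {ρ : Equiv.Perm (Fin m) → L →+* L} (H : GalHyp (Equiv.Perm (Fin m)) R L ρ)
    {t : S ⊗[R] S} (ht1 : Algebra.TensorProduct.lmul' R t = 1)
    (φ : Fin m → S →ₐ[R] L)
    (horth : ∀ i j, i ≠ j → tpair (φ i) (φ j) t = 0)
    (hφ : ∀ g i s, ρ g (φ i s) = φ (g i) s)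
    {Y Z : Type} [Finite Y] [MulAction (Equiv.Perm (Fin m)) Y] [MulAction (Equiv.Perm (Fin m)) Z]
    (π : Z → Y) (hπ : ∀ (g : Equiv.Perm (Fin m)) z, π (g • z) = g • π z)
    (q : Y × Fin m → Z) (hq : ∀ (g : Equiv.Perm (Fin m)) z, q (g • z) = g • q z)
    (hqs : Function.Surjective q) (hqπ : ∀ y, π (q y) = y.1)
    (e : Z ≃ Y × Bool) (he : ∀ z, (e z).1 = π z) :
    ∃ (B : Type) (_ : CommRing B) (_ : Algebra R B) (Q : Type) (_ : CommRing Q) (_ : Algebra B Q)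
      (ι : Q →ₐ[B] B ⊗[R] S),
      Module.Finite R B ∧ Algebra.Etale R B ∧
      Module.rankAtStalk (R := R) B = ((Nat.card Y : ℕ) : PrimeSpectrum R → ℕ) ∧
      Module.Finite B Q ∧ Algebra.Etale B Q ∧
      Module.rankAtStalk (R := B) Q = ((2 : ℕ) : PrimeSpectrum B → ℕ) ∧ Function.Injective ι := by
  have hB : Module.Finite R (FX H Y) ∧ Algebra.Etale R (FX H Y) ∧
      Module.rankAtStalk (R := R) (FX H Y) = ((Nat.card Y : ℕ) : PrimeSpectrum R → ℕ) := by
    refine chr_descent H (eq0 H Y) (Nat.card Y) ?_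
    ext p
    have : Nontrivial L := ⟨0, 1, fun h => p.2.ne_top ((Ideal.eq_top_iff_one _).2 (h ▸ p.1.zero_mem))⟩
    rw [Module.rankAtStalk_eq_finrank_of_free]
    have := Fintype.ofFinite Y
    simp
  let a1 : Algebra (Y → L) (Z → L) := (pullHom L π).toAlgebra
  let a2 : Algebra (FX H Y) (FX H Z) := (pullF H π hπ).toAlgebra
  let jZ : FX H Z →ₐ[FX H Y] (Z → L) :=
    { toRingHom := (FX H Z).val.toRingHom, commutes' := fun _ => rfl }
  have hZ : Module.Finite (FX H Y) (FX H Z) ∧ Algebra.Etale (FX H Y) (FX H Z) ∧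
      Module.rankAtStalk (R := FX H Y) (FX H Z) = ((2 : ℕ) : PrimeSpectrum (FX H Y) → ℕ) := by
    obtain ⟨h1, h2, h3⟩ := split_alg (L := L) π e he (fun _ _ => rfl)
    refine chr_descent (gal1 H Y) (eq1 H π hπ (fun _ _ => rfl) jZ (fun _ => rfl)) 2 ?_
    rw [h3]; simp
  let W := Y × Fin m
  let πW : W → Y := Prod.fst
  have hπW : ∀ (g : Equiv.Perm (Fin m)) z, πW (g • z) = g • πW z := fun _ _ => rfl
  let b1 : Algebra (Y → L) (W → L) := (pullHom L πW).toAlgebra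
  let b2 : Algebra (FX H Y) (FX H W) := (pullF H πW hπW).toAlgebra
  have b3 : IsScalarTower R (FX H Y) (FX H W) := IsScalarTower.of_algebraMap_eq fun _ => rfl
  let jW : FX H W →ₐ[FX H Y] (W → L) :=
    { toRingHom := (FX H W).val.toRingHom, commutes' := fun _ => rfl }
  obtain ⟨w1, w2, w3⟩ := split_alg (L := L) πW (Equiv.refl W) (fun _ => rfl) (fun _ _ => rfl)
  have hW := chr (gal1 H Y) (eq1 H πW hπW (fun _ _ => rfl) jW (fun _ => rfl))
  let sW : S →ₐ[R] FX H W :=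
    { toFun := fun s => ⟨fun w => φ w.2 s, by
        intro g
        ext w
        rw [tw_apply, hφ]
        change φ (g (g⁻¹ w.2)) s = _
        rw [← Equiv.Perm.mul_apply, mul_inv_cancel, Equiv.Perm.one_apply]⟩
      map_one' := Subtype.ext (by ext; simp)
      map_mul' := by intros; exact Subtype.ext (by ext; simp)
      map_zero' := Subtype.ext (by ext; simp)
      map_add' := by intros; exact Subtype.ext (by ext; simp)
      commutes' := by intros; exact Subtype.ext (by ext; simp) }
  let θ : (FX H Y) ⊗[R] S →ₐ[FX H Y] FX H W :=
    Algebra.TensorProduct.lift (Algebra.ofId _ _) sW (fun _ _ => Commute.all _ _)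
  have := (gal1 H Y).ff
  let κ : (FX H Y) ⊗[R] S →ₐ[FX H Y] (W → L) := jW.comp θ
  have hκ (b : FX H Y) (s : S) (w : W) : κ (b ⊗ₜ s) w = b.1 w.1 * φ w.2 s := rfl
  let Ψ : (Y → L) ⊗[FX H Y] ((FX H Y) ⊗[R] S) →ₐ[Y → L] (W → L) :=
    chrMap (A := FX H Y) (C := Y → L) (D := W → L) (F := (FX H Y) ⊗[R] S) κ
  have hc (c : Y → L) (x : (FX H Y) ⊗[R] S) (w : W) :
      Ψ (c ⊗ₜ x) w = c w.1 * κ x w := rfl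
  have hsurj : Function.Surjective (Ψ) := by
    intro h
    let M := (Y → L) ⊗[FX H Y] ((FX H Y) ⊗[R] S)
    have key (i : Fin m) (x : S ⊗[R] S) : ∃ y : M, ∀ w : W,
        Ψ y w = tpair (φ i) (φ w.2) x := by
      induction x with
      | zero => exact ⟨0, fun w => by rw [map_zero, map_zero]; rfl⟩
      | add x x' hx hx' =>
        obtain ⟨y, hy⟩ := hx
        obtain ⟨y', hy'⟩ := hx'
        exact ⟨y + y', fun w => by rw [map_add, map_add, Pi.add_apply, hy, hy']⟩
      | tmul s s' =>
        refine ⟨(fun _ => φ i s) ⊗ₜ (1 ⊗ₜ s'), fun w => ?_⟩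
        rw [hc, hκ]
        simp
    choose ε hε using fun i => key i t
    refine ⟨∑ i, (fun y => h (y, i) : Y → L) • ε i, ?_⟩
    ext w
    rw [map_sum, Finset.sum_apply]
    simp_rw [map_smul]
    have h1 (i : Fin m) : ((fun y => h (y, i) : Y → L) • Ψ (ε i)) w
        = h (w.1, i) * tpair (φ i) (φ w.2) t := by
      rw [Algebra.smul_def, Pi.mul_apply, hε]; rfl
    simp_rw [h1]
    rw [Finset.sum_eq_single w.2]
    · rw [tpair_self, ht1, map_one, mul_one]
    · intro i _ hi
      rw [horth _ _ hi, mul_zero]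
    · simp
  have hθ : Function.Bijective θ := by
    refine bij_aux (C := Y → L) (D := W → L) hm (by rw [w3]; simp) θ jW hW ?_
    exact hsurj
  let Θ := AlgEquiv.ofBijective θ hθ
  let qF : FX H Z →ₐ[FX H Y] FX H W :=
    { toRingHom := (pullF H q hq).toRingHom
      commutes' := by
        intro f
        apply Subtype.ext
        ext w
        change f.1 (π (q w)) = f.1 w.1
        rw [hqπ] }
  refine ⟨FX H Y, inferInstance, inferInstance, FX H Z, inferInstance, inferInstance,
    Θ.symm.toAlgHom.comp qF, hB.1, hB.2.1, hB.2.2, hZ.1, hZ.2.1, hZ.2.2, ?_⟩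
  refine Θ.symm.injective.comp ?_
  intro f g hfg
  apply Subtype.ext
  ext z
  obtain ⟨w, rfl⟩ := hqs z
  exact congrFun (congrArg Subtype.val hfg) w

/-- half subsets -/
def ZT (m h : ℕ) : Type := {f : Fin m → Bool // (Finset.univ.filter (fun i => f i = true)).card = h}

/-- half-half partitions -/
def YT (m h : ℕ) : Type := {r : Fin m → Fin m → Bool // ∃ f : ZT m h, r = fun i j => f.1 i == f.1 j}

instance (m h : ℕ) : Finite (ZT m h) := by unfold ZT; infer_instance
instance (m h : ℕ) : Finite (YT m h) := by unfold YT; infer_instance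

theorem ZT_perm {m h : ℕ} (g : Equiv.Perm (Fin m)) (f : ZT m h) :
    (Finset.univ.filter (fun i => f.1 (g⁻¹ i) = true)).card = h := by
  refine Eq.trans ?_ f.2
  refine Finset.card_bij' (fun i _ => g⁻¹ i) (fun i _ => g i) ?_ ?_ ?_ ?_
  · intro i hi; simpa using hi
  · intro i hi
    simp only [Finset.mem_filter, Finset.mem_univ, true_and] at hi ⊢
    rw [← Equiv.Perm.mul_apply, inv_mul_cancel, Equiv.Perm.one_apply]; exact hi
  · intro i hi
    rw [← Equiv.Perm.mul_apply, mul_inv_cancel, Equiv.Perm.one_apply]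
  · intro i hi
    rw [← Equiv.Perm.mul_apply, inv_mul_cancel, Equiv.Perm.one_apply]

instance (m h : ℕ) : MulAction (Equiv.Perm (Fin m)) (ZT m h) where
  smul g f := ⟨fun i => f.1 (g⁻¹ i), ZT_perm g f⟩
  one_smul f := Subtype.ext (by ext i; change f.1 ((1 : Equiv.Perm (Fin m))⁻¹ i) = f.1 i; simp)
  mul_smul a b f := Subtype.ext (by
    ext i
    change f.1 ((a * b)⁻¹ i) = f.1 (b⁻¹ (a⁻¹ i))
    rw [mul_inv_rev]; rfl)

instance (m h : ℕ) : MulAction (Equiv.Perm (Fin m)) (YT m h) where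
  smul g r := ⟨fun i j => r.1 (g⁻¹ i) (g⁻¹ j), by
    obtain ⟨r, f, rfl⟩ := r
    exact ⟨g • f, rfl⟩⟩
  one_smul f := Subtype.ext (by
    ext i j; change f.1 ((1 : Equiv.Perm (Fin m))⁻¹ i) ((1 : Equiv.Perm (Fin m))⁻¹ j) = f.1 i j; simp)
  mul_smul a b f := Subtype.ext (by
    ext i j
    change f.1 ((a * b)⁻¹ i) ((a * b)⁻¹ j) = f.1 (b⁻¹ (a⁻¹ i)) (b⁻¹ (a⁻¹ j))
    rw [mul_inv_rev]; rfl)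

theorem ZT_flip {m h : ℕ} (hm : m = 2 * h) (f : ZT m h) (b : Bool) :
    (Finset.univ.filter (fun i => (b == f.1 i) = true)).card = h := by
  cases b with
  | true => simpa using f.2
  | false =>
    have h1 := Finset.card_filter_add_card_filter_not (s := (Finset.univ : Finset (Fin m)))
      (fun i => f.1 i = true)
    rw [f.2, Finset.card_univ, Fintype.card_fin] at h1
    have h2 : (Finset.univ.filter (fun i => (false == f.1 i) = true)) =
      Finset.univ.filter (fun i => ¬ f.1 i = true) := by
      ext i; simp
    rw [h2]; omega

theorem comb (m h : ℕ) (hm : m = 2 * h) (hh : 0 < h) :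
    ∃ (π : ZT m h → YT m h) (q : YT m h × Fin m → ZT m h) (e : ZT m h ≃ YT m h × Bool),
      (∀ (g : Equiv.Perm (Fin m)) z, π (g • z) = g • π z) ∧
      (∀ (g : Equiv.Perm (Fin m)) z, q (g • z) = g • q z) ∧
      Function.Surjective q ∧ (∀ y, π (q y) = y.1) ∧ (∀ z, (e z).1 = π z) := by
  let π : ZT m h → YT m h := fun f => ⟨fun i j => f.1 i == f.1 j, f, rfl⟩
  let q : YT m h × Fin m → ZT m h := fun y => ⟨fun j => y.1.1 y.2 j, by
    obtain ⟨⟨r, f, rfl⟩, i⟩ := y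
    exact ZT_flip hm f (f.1 i)⟩
  let i0 : Fin m := ⟨0, by omega⟩
  have hbij : Function.Bijective (fun f : ZT m h => (π f, f.1 i0)) := by
    constructor
    · intro f f' hff
      simp only [Prod.mk.injEq] at hff
      obtain ⟨h1, h2⟩ := hff
      apply Subtype.ext
      ext j
      have h3 := congrFun (congrFun (congrArg Subtype.val h1) i0) j
      change (f.1 i0 == f.1 j) = (f'.1 i0 == f'.1 j) at h3
      rw [h2] at h3
      revert h3
      cases f.1 j <;> cases f'.1 j <;> cases f'.1 i0 <;> simp
    · rintro ⟨⟨r, f, rfl⟩, b⟩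
      refine ⟨⟨fun j => (b == f.1 i0) == f.1 j, ZT_flip hm f _⟩, ?_⟩
      refine Prod.ext (Subtype.ext ?_) ?_
      · ext i j
        change (((b == f.1 i0) == f.1 i) == ((b == f.1 i0) == f.1 j)) = (f.1 i == f.1 j)
        cases b <;> cases f.1 i0 <;> cases f.1 i <;> cases f.1 j <;> rfl
      · change ((b == f.1 i0) == f.1 i0) = b
        cases b <;> cases f.1 i0 <;> rfl
  refine ⟨π, q, Equiv.ofBijective _ hbij, fun _ _ => rfl, ?_, ?_, ?_, fun _ => rfl⟩
  · intro g y
    apply Subtype.ext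
    ext j
    change y.1.1 (g⁻¹ (g y.2)) (g⁻¹ j) = y.1.1 y.2 (g⁻¹ j)
    rw [← Equiv.Perm.mul_apply, inv_mul_cancel, Equiv.Perm.one_apply]
  · intro f
    have : (Finset.univ.filter (fun i => f.1 i = true)).Nonempty := by
      rw [← Finset.card_pos, f.2]; exact hh
    obtain ⟨i, hi⟩ := this
    simp only [Finset.mem_filter, Finset.mem_univ, true_and] at hi
    refine ⟨(π f, i), Subtype.ext ?_⟩
    ext j
    change (f.1 i == f.1 j) = f.1 j
    rw [hi]; simp
  · rintro ⟨⟨r, f, rfl⟩, i⟩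
    apply Subtype.ext
    ext j k
    change ((f.1 i == f.1 j) == (f.1 i == f.1 k)) = (f.1 j == f.1 k)
    cases f.1 i <;> cases f.1 j <;> cases f.1 k <;> rfl

theorem card_ZT (m h : ℕ) : Nat.card (ZT m h) = m.choose h := by
  have e : ZT m h ≃ {s : Finset (Fin m) // s.card = h} :=
    Equiv.subtypeEquiv
      { toFun := fun f => Finset.univ.filter (fun i => f i = true)
        invFun := fun s i => decide (i ∈ s)
        left_inv := by intro f; ext i; simp
        right_inv := by intro s; ext i; simp }
      (fun f => Iff.rfl)
  rw [Nat.card_congr e, Nat.card_eq_fintype_card, Fintype.card_finset_len, Fintype.card_fin]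

theorem odd_YT (n : ℕ) : Odd (Nat.card (YT (2 ^ (n + 1)) (2 ^ n))) := by
  obtain ⟨_, _, e, _⟩ := comb (2 ^ (n + 1)) (2 ^ n) (by ring) (by positivity)
  have h1 := Nat.card_congr e
  rw [card_ZT, Nat.card_prod, Nat.card_eq_fintype_card (α := Bool), Fintype.card_bool] at h1
  rw [← Nat.not_even_iff_odd]
  rintro ⟨c, hc⟩
  have h2 := Nat.factorization_choose_prime_pow_add_factorization (p := 2) (n := n + 1) (k := 2 ^ n)
    Nat.prime_two (Nat.pow_le_pow_right (by norm_num) (by omega)) (by positivity)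
  rw [Nat.prime_two.factorization_pow] at h2
  simp only [Finsupp.single_eq_same] at h2
  have h3 : 2 ^ 2 ∣ (2 ^ (n + 1)).choose (2 ^ n) := ⟨c, by rw [h1, hc]; ring⟩
  have h4 : (2 ^ (n + 1)).choose (2 ^ n) ≠ 0 :=
    (Nat.choose_pos (Nat.pow_le_pow_right (by norm_num) (by omega))).ne'
  have := (Nat.prime_two.pow_dvd_iff_le_factorization h4).1 h3
  omega

theorem base_sub {R S B T Q : Type} [CommRing R] [CommRing S] [CommRing B] [CommRing T] [CommRing Q]
    [Algebra R S] [Algebra R B] [Algebra R T] [Algebra B T] [IsScalarTower R B T] [Algebra B Q]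
    [Module.Flat B T] [Module.Finite B Q] [Algebra.Etale B Q]
    (hQ : Module.rankAtStalk (R := B) Q = ((2 : ℕ) : PrimeSpectrum B → ℕ))
    (ι : Q →ₐ[B] B ⊗[R] S) (hι : Function.Injective ι) :
    ∃ Q' : Subalgebra T (T ⊗[R] S), Module.Finite T Q' ∧ Algebra.Etale T Q' ∧
      Module.rankAtStalk (R := T) Q' = ((2 : ℕ) : PrimeSpectrum T → ℕ) := by
  let f1 : T ⊗[B] Q →ₐ[T] T ⊗[B] (B ⊗[R] S) := Algebra.TensorProduct.map (AlgHom.id T T) ι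
  have hf1 : Function.Injective f1 := Module.Flat.lTensor_preserves_injective_linearMap ι.toLinearMap hι
  let f : T ⊗[B] Q →ₐ[T] T ⊗[R] S :=
    (Algebra.TensorProduct.cancelBaseChange R B T T S).toAlgHom.comp f1
  have hf : Function.Injective f := (Algebra.TensorProduct.cancelBaseChange R B T T S).injective.comp hf1
  let e : T ⊗[B] Q ≃ₐ[T] f.range := AlgEquiv.ofInjective f hf
  refine ⟨f.range, Module.Finite.equiv e.toLinearEquiv, Algebra.Etale.of_equiv e, ?_⟩
  rw [← Module.rankAtStalk_eq_of_equiv e.toLinearEquiv]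
  ext p
  rw [Module.rankAtStalk_baseChange, hQ]
  rfl

theorem exists_odd_extension_with_quadratic_subalgebra
    (R : Type) [CommRing R] (hsemi : IsSemilocalRing R) (hconn : IsConnectedRing R)
    (S : Type) [CommRing S] [Algebra R S]
    (hSet : IsFiniteEtale R S) (hSconn : IsConnectedRing S)
    (n : ℕ) (hn : 1 ≤ n)
    (hSrank : ∀ (p : Ideal R), p.IsPrime → rankAt R S p = 2 ^ n) :
    ∃ (T : Type) (_ : CommRing T) (_ : Algebra R T),
      IsFiniteEtale R T ∧ IsConnectedRing T ∧
      (∃ k : ℕ, Odd k ∧ ∀ (p : Ideal R), p.IsPrime → rankAt R T p = k) ∧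
      IsConnectedRing (T ⊗[R] S) ∧
      (∃ Q : Subalgebra T (T ⊗[R] S),
        IsFiniteEtale T Q ∧
        ∀ (q : Ideal T), q.IsPrime → rankAt T Q q = 2) := by
  obtain ⟨hSf, hSe⟩ := isFiniteEtale_iff.1 hSet
  obtain ⟨t, ht, ht1⟩ := isSep_iff.1 hSet.2.2
  obtain ⟨k, rfl⟩ : ∃ k, n = k + 1 := ⟨n - 1, by omega⟩
  have hm : Module.rankAtStalk (R := R) S = ((2 ^ (k + 1) : ℕ) : PrimeSpectrum R → ℕ) := by
    ext p
    rw [← rankAt_eq p.1 p.2, hSrank p.1 p.2]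
    rfl
  obtain ⟨E, _, _, act, φ, horth, hfix, hφ, hinv, hinj, hdual⟩ := exists_galois R S hconn hm ht ht1
  have H : GalHyp (Equiv.Perm (Fin (2 ^ (k + 1)))) R E
      (fun g => MulSemiringAction.toRingHom (Equiv.Perm (Fin (2 ^ (k + 1)))) E g) :=
    { one := fun c => one_smul _ c
      mul := fun g h c => mul_smul g h c
      fix := hfix
      inv := hinv
      inj := hinj
      dual := hdual }
  obtain ⟨π, q, e, hπ, hq, hqs, hqπ, he⟩ := comb (2 ^ (k + 1)) (2 ^ k) (by ring) (by positivity)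
  obtain ⟨B, _, _, Q, _, _, ι, hB1, hB2, hB3, hQ1, hQ2, hQ3, hι⟩ :=
    main_alg hm H ht1 φ horth hφ π hπ q hq hqs hqπ e he
  obtain ⟨T, _, _, hT1, hT2, hT3, ⟨k', hk', hT4⟩, ⟨f⟩⟩ := exists_odd_component hconn _ (odd_YT k) B hB3
  let _ : Algebra B T := f.toRingHom.toAlgebra
  have : IsScalarTower R B T := IsScalarTower.of_algebraMap_eq fun r => (f.commutes r).symm
  have : Algebra.Etale B T := Algebra.Etale.of_restrictScalars R B T
  obtain ⟨Q', hq1, hq2, hq3⟩ := base_sub (T := T) hQ3 ι hι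
  have := proj_of_etale R T
  have := proj_of_etale T Q'
  refine ⟨T, inferInstance, inferInstance, isFiniteEtale_iff.2 ⟨hT1, hT2⟩, hT3,
    ⟨k', hk', fun p hp => ?_⟩, ?_, Q', isFiniteEtale_iff.2 ⟨hq1, hq2⟩, fun p hp => ?_⟩
  · rw [rankAt_eq p hp, hT4]; rfl
  · exact connected_tensor hconn hT3 hSconn (by positivity)
      (Nat.Coprime.pow_right _ (Nat.coprime_two_right.2 hk')) hT4 hm
  · rw [rankAt_eq p hp, hq3]; rfl

end
end
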